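/- arXiv:1606.05950 — 4 statements merged into one kernel-verified Lean document; each statement's English description precedes it below -/
import Mathlib

section
/- Let G be a bicyclic graph of order n ≥ 5 whose diameter equals n − 2. Then Sz(G)/W(G) ≥ 1 + 12(n−3)/(n³ − 13n + 30), with equality if and only if G is isomorphic to B(n,0). -/
open SimpleGraph Finset
open scoped Classical

noncomputable section

/-- The Wiener index of a graph, as a rational number: half of the sum of
distances over all ordered pairs of vertices (i.e. the sum over unordered pairs). -/
def wienerIndex {V : Type*} [Fintype V] (G : SimpleGraph V) : ℚ :=
  (∑ u : V, ∑ v : V, (G.dist u v : ℚ)) / 2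

/-- The transmission `D_G(v)` of a vertex: the sum of distances to all vertices. -/
def transmission {V : Type*} [Fintype V] (G : SimpleGraph V) (v : V) : ℚ :=
  ∑ x : V, (G.dist x v : ℚ)

/-- `n_u(e)` for `e = uv`: the number of vertices strictly closer to `u` than to `v`. -/
def nCloser {V : Type*} [Fintype V] (G : SimpleGraph V) (u v : V) : ℕ :=
  (Finset.univ.filter fun w => G.dist u w < G.dist v w).card

/-- `n_0(e)` for `e = uv`: the number of vertices equidistant from `u` and `v`. -/
def nEqual {V : Type*} [Fintype V] (G : SimpleGraph V) (u v : V) : ℕ :=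
  (Finset.univ.filter fun w => G.dist u w = G.dist v w).card

/-- The Szeged index, as a rational number (each edge is counted once). -/
def szeged {V : Type*} [Fintype V] (G : SimpleGraph V) : ℚ :=
  (∑ u : V, ∑ v : V,
    if G.Adj u v then (nCloser G u v : ℚ) * (nCloser G v u : ℚ) else 0) / 2

/-- The revised Szeged index, as a rational number (each edge is counted once). -/
def szegedStar {V : Type*} [Fintype V] (G : SimpleGraph V) : ℚ :=
  (∑ u : V, ∑ v : V,
    if G.Adj u v then
      ((nCloser G u v : ℚ) + (nEqual G u v : ℚ) / 2) *
        ((nCloser G v u : ℚ) + (nEqual G u v : ℚ) / 2)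
    else 0) / 2

/-- The cycle `C_k` on the vertices `0, 1, …, k-1`. -/
def cycleG (k : ℕ) : SimpleGraph (Fin k) :=
  SimpleGraph.fromRel (fun a b => a.val + 1 = b.val ∨ (a.val = 0 ∧ b.val = k - 1))

/-- The lollipop `L_{n,r}`: the cycle `C_r` on `0, …, r-1` together with the
path `r-1, r, …, n-1` attached at the cycle vertex `r-1`. -/
def lollipop (n r : ℕ) : SimpleGraph (Fin n) :=
  SimpleGraph.fromRel (fun a b => a.val + 1 = b.val ∨ (a.val = 0 ∧ b.val = r - 1))

/-- `H_n^0`: a triangle `0,1,2`, a path `2, 3, …, n-3` (so `u_1 = 2`, `u_{n-4} = n-3`)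
and two pendant vertices `n-2, n-1` attached at `n-3`. -/
def Hgraph0 (n : ℕ) : SimpleGraph (Fin n) :=
  SimpleGraph.fromRel (fun a b =>
    (a.val + 1 = b.val ∧ b.val ≤ n - 2) ∨ (a.val = 0 ∧ b.val = 2) ∨
    (a.val = n - 3 ∧ b.val = n - 1))

/-- `H_n^1`: a triangle `0,1,2`, a path `2, 3, …, n-4` (so `u_1 = 2`, `u_{n-5} = n-4`),
a path of length two `n-4, n-3, n-2` and a pendant vertex `n-1` attached at `n-4`. -/
def Hgraph1 (n : ℕ) : SimpleGraph (Fin n) :=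
  SimpleGraph.fromRel (fun a b =>
    (a.val + 1 = b.val ∧ b.val ≤ n - 2) ∨ (a.val = 0 ∧ b.val = 2) ∨
    (a.val = n - 4 ∧ b.val = n - 1))

/-- `H_n^2`: a `4`-cycle `0,1,2,3`, a path `3, 4, …, n-3` (so `u_1 = 3`, `u_{n-5} = n-3`)
and two pendant vertices `n-2, n-1` attached at `n-3`. -/
def Hgraph2 (n : ℕ) : SimpleGraph (Fin n) :=
  SimpleGraph.fromRel (fun a b =>
    (a.val + 1 = b.val ∧ b.val ≤ n - 2) ∨ (a.val = 0 ∧ b.val = 3) ∨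
    (a.val = n - 3 ∧ b.val = n - 1))

/-- `H_n^3`: a triangle `0,1,2`, a path `2, 3, …, n-4` (so `u_1 = 2`, `u_{n-5} = n-4`),
two pendant vertices `n-3, n-2` attached at `n-4`, and a pendant vertex `n-1`
attached at the second triangle vertex `0`. -/
def Hgraph3 (n : ℕ) : SimpleGraph (Fin n) :=
  SimpleGraph.fromRel (fun a b =>
    (a.val + 1 = b.val ∧ b.val ≤ n - 3) ∨ (a.val = 0 ∧ b.val = 2) ∨
    (a.val = n - 4 ∧ b.val = n - 2) ∨ (a.val = 0 ∧ b.val = n - 1))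

/-- `B(n,s)`: `K_4^-` on the vertices `x = n-s-4`, `u = n-s-3`, `y = n-s-2`, `v = n-1`
(with the edge `xy` missing), a path on `n-s-4` vertices `0, …, n-s-5` attached at `x`,
and a path on `s` vertices `n-s-1, …, n-2` attached at `y`. -/
def Bgraph (n s : ℕ) : SimpleGraph (Fin n) :=
  SimpleGraph.fromRel (fun a b =>
    (a.val + 1 = b.val ∧ b.val ≤ n - 2) ∨
    (b.val = n - 1 ∧ (a.val = n - s - 4 ∨ a.val = n - s - 3 ∨ a.val = n - s - 2)))

/-- `B_n^{(1)}`: `K_4^-` on the vertices `n-4, n-3, n-2, n-1` (with the edge between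
`n-2` and `n-1` missing), with an end-vertex of the path `0, 1, …, n-4` identified with
the degree-`3` vertex `n-4` of `K_4^-`. -/
def Bn1 (n : ℕ) : SimpleGraph (Fin n) :=
  SimpleGraph.fromRel (fun a b =>
    (a.val + 1 = b.val ∧ b.val ≤ n - 3) ∨
    (a.val = n - 4 ∧ b.val = n - 2) ∨ (a.val = n - 4 ∧ b.val = n - 1) ∨
    (a.val = n - 3 ∧ b.val = n - 2) ∨ (a.val = n - 3 ∧ b.val = n - 1))

/-- `B_n^{3,3}`: two triangles `0,1,2` and `n-3,n-2,n-1` joined by the path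
`2, 3, …, n-3` of length `n-5`. -/
def B33 (n : ℕ) : SimpleGraph (Fin n) :=
  SimpleGraph.fromRel (fun a b =>
    a.val + 1 = b.val ∨ (a.val = 0 ∧ b.val = 2) ∨ (a.val = n - 3 ∧ b.val = n - 1))

/-- `C_r(P_{m 0 + 1}, …, P_{m (r-1) + 1})`: the unicyclic graph obtained from the cycle
`C_r` by identifying, for each `i`, one end-vertex of a path on `m i + 1` vertices with
the `i`-th cycle vertex.  The vertex `⟨i, 0⟩` is the cycle vertex `v_i`, and `⟨i, j⟩`
for `j ≥ 1` are the remaining vertices of the path attached at `v_i`. -/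
def cyclePaths (r : ℕ) (m : Fin r → ℕ) : SimpleGraph (Σ i : Fin r, Fin (m i + 1)) :=
  SimpleGraph.fromRel (fun a b =>
    (a.2.val = 0 ∧ b.2.val = 0 ∧ (a.1.val + 1) % r = b.1.val) ∨
    (a.1 = b.1 ∧ a.2.val + 1 = b.2.val))

/-- The graph obtained from vertex-disjoint graphs `G₁`, `G₂` by identifying the
vertex `v₁` of `G₁` with the vertex `v₂` of `G₂`; the common vertex is `Sum.inl v₁`. -/
def glue {V₁ V₂ : Type*} (G₁ : SimpleGraph V₁) (G₂ : SimpleGraph V₂) (v₁ : V₁) (v₂ : V₂) :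
    SimpleGraph (V₁ ⊕ {x : V₂ // x ≠ v₂}) :=
  SimpleGraph.fromRel (fun a b =>
    match a, b with
    | Sum.inl a, Sum.inl b => G₁.Adj a b
    | Sum.inr a, Sum.inr b => G₂.Adj a.val b.val
    | Sum.inl a, Sum.inr b => a = v₁ ∧ G₂.Adj v₂ b.val
    | Sum.inr _, Sum.inl _ => False)

/-- The spider `A_{n,4}`: a center `n-5` with one leg `n-5, n-6, …, 0` of length
`n-5` and four legs of length one ending at the unit leaves `n-4, n-3, n-2, n-1`;
the non-unit leaf is the vertex `0`. -/
def spiderA (n : ℕ) : SimpleGraph (Fin n) :=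
  SimpleGraph.fromRel (fun a b =>
    (a.val + 1 = b.val ∧ b.val ≤ n - 5) ∨ (a.val = n - 5 ∧ n - 4 ≤ b.val))

/-- The theta graph `B_{k,l,t}` on `k + l + t - 1` vertices: the vertices `u = 0` and
`w = k` joined by three internally disjoint paths of lengths `k`, `l`, `t`, with
internal vertices `1, …, k-1`, `k+1, …, k+l-1` and `k+l, …, k+l+t-2` respectively. -/
def theta (k l t : ℕ) : SimpleGraph (Fin (k + l + t - 1)) :=
  SimpleGraph.fromRel (fun a b =>
    (a.val + 1 = b.val ∧ b.val ≤ k) ∨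
    (a.val = 0 ∧ b.val = k + 1) ∨
    (a.val + 1 = b.val ∧ k + 1 ≤ a.val ∧ b.val ≤ k + l - 1) ∨
    (a.val = k ∧ b.val = k + l - 1) ∨
    (a.val = 0 ∧ b.val = k + l) ∨
    (a.val + 1 = b.val ∧ k + l ≤ a.val ∧ b.val ≤ k + l + t - 2) ∨
    (a.val = k ∧ b.val = k + l + t - 2))

/-- A set of vertices `B` induces a subgraph with no cut vertex. -/
def NoCutVtx {V : Type*} (G : SimpleGraph V) (B : Set V) : Prop :=
  ∀ v ∈ B, (G.induce (B \ {v})).Preconnected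

/-- `B` is (the vertex set of) a block of `G`: a maximal connected subgraph of `G`
without a cut vertex. -/
def IsBlock {V : Type*} (G : SimpleGraph V) (B : Set V) : Prop :=
  (G.induce B).Connected ∧ NoCutVtx G B ∧
  ∀ C : Set V, B ⊆ C → (G.induce C).Connected → NoCutVtx G C → C = B

/-- The level of the vertex `i` of `Bgraph (a + b + 4) b`: its position on the long path,
the extra vertex `a + b + 3` being on the level of its twin `a + 1`. -/
def level (a b i : ℕ) : ℕ := if i = a + b + 3 then a + 1 else i

lemma Bgraph_adj_iff (a b : ℕ) (i j : Fin (a + b + 4)) :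
    (Bgraph (a + b + 4) b).Adj i j ↔
      i ≠ j ∧ level a b i ≤ level a b j + 1 ∧ level a b j ≤ level a b i + 1 := by
  have hi := i.isLt
  have hj := j.isLt
  simp only [Bgraph, SimpleGraph.fromRel_adj, level, ne_eq, Fin.ext_iff]
  split_ifs <;> omega

lemma Bgraph_adj_iff_of_eq {n a b : ℕ} (h : a + b + 4 = n) {i j : Fin n} :
    (Bgraph n b).Adj i j ↔
      i ≠ j ∧ level a b i ≤ level a b j + 1 ∧ level a b j ≤ level a b i + 1 := by
  subst h
  exact Bgraph_adj_iff a b i j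

lemma level_le (a b : ℕ) (i : Fin (a + b + 4)) : level a b i ≤ a + b + 2 := by
  have hi := i.isLt
  simp only [level]
  split_ifs <;> omega

/-- The distance function of `Bgraph (a + b + 4) b`. -/
def levelDist (a b i j : ℕ) : ℕ :=
  if i = j then 0 else
    max 1 ((level a b i - level a b j) + (level a b j - level a b i))

lemma level_le_add_length (a b : ℕ) {i j : Fin (a + b + 4)}
    (p : (Bgraph (a + b + 4) b).Walk i j) :
    level a b i ≤ level a b j + p.length ∧ level a b j ≤ level a b i + p.length := by
  induction p with
  | nil => simp
  | cons h p ih =>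
    rw [Bgraph_adj_iff] at h
    simp only [SimpleGraph.Walk.length_cons]
    omega

lemma exists_walk_of_level_lt (a b d : ℕ) (i j : Fin (a + b + 4))
    (h : level a b j = level a b i + (d + 1)) :
    ∃ p : (Bgraph (a + b + 4) b).Walk i j, p.length = d + 1 := by
  induction d generalizing i with
  | zero =>
    refine ⟨SimpleGraph.Walk.cons ((Bgraph_adj_iff a b i j).2 ⟨?_, by omega⟩) .nil, by simp⟩
    rintro rfl
    omega
  | succ d ih =>
    have hj := level_le a b j
    let k : Fin (a + b + 4) := ⟨level a b i + 1, by omega⟩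
    have hk : level a b k = level a b i + 1 := by
      have : (k : ℕ) ≠ a + b + 3 := by simp only [k]; omega
      simp only [level, this, if_false]
      rfl
    obtain ⟨p, hp⟩ := ih k (by omega)
    refine ⟨SimpleGraph.Walk.cons ((Bgraph_adj_iff a b i k).2 ⟨?_, by omega⟩) p, by simp [hp]⟩
    intro hik
    rw [← hik] at hk
    omega

lemma exists_walk_length_eq_levelDist (a b : ℕ) (i j : Fin (a + b + 4)) :
    ∃ p : (Bgraph (a + b + 4) b).Walk i j, p.length = levelDist a b i j := by
  by_cases hij : i = j
  · subst hij
    exact ⟨.nil, by simp [levelDist]⟩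
  have hij' : (i : ℕ) ≠ j := fun h => hij (Fin.ext h)
  simp only [levelDist, hij', if_false]
  rcases lt_trichotomy (level a b i) (level a b j) with h | h | h
  · obtain ⟨p, hp⟩ := exists_walk_of_level_lt a b (level a b j - level a b i - 1) i j (by omega)
    exact ⟨p, by omega⟩
  · exact ⟨SimpleGraph.Walk.cons ((Bgraph_adj_iff a b i j).2 ⟨hij, by omega⟩) .nil,
      by simp [h]⟩
  · obtain ⟨p, hp⟩ := exists_walk_of_level_lt a b (level a b i - level a b j - 1) j i (by omega)
    exact ⟨p.reverse, by rw [SimpleGraph.Walk.length_reverse]; omega⟩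

lemma Bgraph_dist (a b : ℕ) (i j : Fin (a + b + 4)) :
    (Bgraph (a + b + 4) b).dist i j = levelDist a b i j := by
  obtain ⟨p, hp⟩ := exists_walk_length_eq_levelDist a b i j
  apply le_antisymm (hp ▸ SimpleGraph.dist_le p)
  obtain ⟨q, hq⟩ := p.reachable.exists_walk_length_eq_dist
  have h := level_le_add_length a b q
  rw [← hq]
  by_cases hij : i = j
  · simp [levelDist, hij]
  have hij' : (i : ℕ) ≠ j := fun h => hij (Fin.ext h)
  have h0 : q.length ≠ 0 := fun h0 => hij (SimpleGraph.Walk.eq_of_length_eq_zero h0)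
  simp only [levelDist, hij', if_false]
  omega

lemma sum_range_square (m : ℕ) (F : ℕ → ℕ → ℚ) (hF : ∀ i j, F i j = F j i) :
    ∑ i ∈ range (m + 1), ∑ j ∈ range (m + 1), F i j =
      ∑ i ∈ range m, ∑ j ∈ range m, F i j + 2 * ∑ i ∈ range m, F i m + F m m := by
  simp only [sum_range_succ, sum_add_distrib]
  rw [sum_congr rfl fun i _ => hF m i]
  ring

lemma sum_fin_symmetric (m : ℕ) (F : ℕ → ℕ → ℚ) (hF : ∀ i j, F i j = F j i) :
    ∑ i : Fin (m + 1), ∑ j : Fin (m + 1), F i j =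
      ∑ i ∈ range m, ∑ j ∈ range m, F i j + 2 * ∑ i ∈ range m, F i m + F m m := by
  have h (i : ℕ) : ∑ j : Fin (m + 1), F i j = ∑ j ∈ range (m + 1), F i j :=
    Fin.sum_univ_eq_sum_range (F i) (m + 1)
  simp_rw [h]
  rw [Fin.sum_univ_eq_sum_range (fun i => ∑ j ∈ range (m + 1), F i j) (m + 1),
    sum_range_square m F hF]

lemma sum_range_cast_add_one (m : ℕ) :
    ∑ i ∈ range m, ((i : ℚ) + 1) = m * (m + 1) / 2 := by
  induction m with
  | zero => simp
  | succ m ih => rw [sum_range_succ, ih]; push_cast; ring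

/-- The path distance between natural numbers. -/
def absDiff (i j : ℕ) : ℚ := |(i : ℚ) - j|

lemma absDiff_comm (i j : ℕ) : absDiff i j = absDiff j i := abs_sub_comm _ _

lemma sum_absDiff (a b : ℕ) :
    ∑ i ∈ range (a + 1 + b), absDiff i a = a * (a + 1) / 2 + b * (b + 1) / 2 := by
  rw [sum_range_add, sum_range_succ, ← sum_range_reflect]
  have h1 : ∑ j ∈ range a, absDiff (a - 1 - j) a = ∑ j ∈ range a, ((j : ℚ) + 1) := by
    refine sum_congr rfl fun j hj => ?_
    have hj := mem_range.1 hj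
    have : ((a - 1 - j : ℕ) : ℚ) = a - 1 - j := by
      rw [Nat.cast_sub (by omega), Nat.cast_sub (by omega)]; simp
    rw [absDiff, this, show (a : ℚ) - 1 - j - a = -(j + 1) by ring, abs_neg,
      abs_of_nonneg (by positivity)]
  have h2 : ∑ j ∈ range b, absDiff (a + 1 + j) a = ∑ j ∈ range b, ((j : ℚ) + 1) := by
    refine sum_congr rfl fun j _ => ?_
    rw [absDiff, abs_of_nonneg (by push_cast; linarith [(Nat.cast_nonneg j : (0 : ℚ) ≤ j)])]
    push_cast
    ring
  rw [h1, h2, sum_range_cast_add_one, sum_range_cast_add_one]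
  simp [absDiff]

lemma sum_sum_absDiff (m : ℕ) :
    ∑ i ∈ range m, ∑ j ∈ range m, absDiff i j = ((m : ℚ) ^ 3 - m) / 3 := by
  induction m with
  | zero => simp
  | succ m ih =>
    have h := sum_absDiff m 0
    rw [add_zero, sum_range_succ] at h
    have h0 : absDiff m m = 0 := by simp [absDiff]
    rw [h0] at h
    rw [sum_range_square m _ absDiff_comm, ih, h0, ← add_zero (∑ i ∈ range m, absDiff i m), h]
    push_cast
    ring

lemma cast_levelDist_of_lt {a b i j : ℕ} (hi : i < a + b + 3) (hj : j < a + b + 3) :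
    (levelDist a b i j : ℚ) = absDiff i j := by
  simp only [levelDist, level, hi.ne, hj.ne, if_false, absDiff]
  rcases lt_trichotomy i j with h | rfl | h
  · rw [if_neg h.ne, show max 1 (i - j + (j - i)) = j - i by omega, Nat.cast_sub h.le,
      abs_sub_comm, abs_of_nonneg (sub_nonneg.2 (Nat.cast_le.2 h.le))]
  · simp
  · rw [if_neg h.ne', show max 1 (i - j + (j - i)) = i - j by omega, Nat.cast_sub h.le,
      abs_of_nonneg (sub_nonneg.2 (Nat.cast_le.2 h.le))]

lemma cast_levelDist_last {a b i : ℕ} (hi : i < a + b + 3) :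
    (levelDist a b i (a + b + 3) : ℚ) = absDiff i (a + 1) + if i = a + 1 then 1 else 0 := by
  rw [← cast_levelDist_of_lt (a := a) (b := b) hi (show a + 1 < a + b + 3 by omega)]
  simp only [levelDist, level, hi.ne, if_false, if_true,
    show a + 1 ≠ a + b + 3 by omega]
  split_ifs with h
  · simp [h]
  · simp

lemma levelDist_comm (a b i j : ℕ) : levelDist a b i j = levelDist a b j i := by
  simp only [levelDist, eq_comm (a := i), add_comm (level a b i - level a b j)]

lemma wienerIndex_Bgraph (a b : ℕ) :
    wienerIndex (Bgraph (a + b + 4) b) =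
      (((a : ℚ) + b + 4) ^ 3 - 13 * (a + b + 4) + 30) / 6 - a * b := by
  simp only [wienerIndex, Bgraph_dist]
  rw [sum_fin_symmetric (a + b + 3) (fun i j => (levelDist a b i j : ℚ))
    (fun i j => by rw [levelDist_comm])]
  rw [sum_congr rfl fun i hi => sum_congr rfl fun j hj =>
      cast_levelDist_of_lt (a := a) (b := b) (mem_range.1 hi) (mem_range.1 hj),
    sum_congr rfl fun i hi => cast_levelDist_last (a := a) (b := b) (mem_range.1 hi),
    sum_sum_absDiff, sum_add_distrib, sum_ite_eq', if_pos (mem_range.2 (by omega))]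
  have h := sum_absDiff (a + 1) (b + 1)
  rw [show a + 1 + 1 + (b + 1) = a + b + 3 by ring] at h
  rw [h]
  simp only [levelDist, if_true]
  push_cast
  ring

lemma card_filter_level_lt (a b c : ℕ) (hc : c ≤ a + b + 2) :
    #{w : Fin (a + b + 4) | level a b w < c} = c + if a + 1 < c then 1 else 0 := by
  rw [card_filter, Fin.sum_univ_eq_sum_range (fun i => if level a b i < c then 1 else 0),
    sum_range_succ, sum_congr rfl (g := fun i => if i < c then 1 else 0), ← card_filter,
    show (range (a + b + 3)).filter (· < c) = range c by ext i; simp; omega, card_range]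
  · simp [level]
  · intro i hi
    simp [level, (mem_range.1 hi).ne]

lemma card_filter_lt_level (a b c : ℕ) :
    #{w : Fin (a + b + 4) | c < level a b w} = (a + b + 2 - c) + if c < a + 1 then 1 else 0 := by
  rw [card_filter, Fin.sum_univ_eq_sum_range (fun i => if c < level a b i then 1 else 0),
    sum_range_succ, sum_congr rfl (g := fun i => if c < i then 1 else 0), ← card_filter,
    show (range (a + b + 3)).filter (c < ·) = Ico (c + 1) (a + b + 3) by ext i; simp; omega,
    Nat.card_Ico]
  · simp only [level, if_true]
    omega
  · intro i hi
    simp [level, (mem_range.1 hi).ne]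

/-- The number of vertices of `Bgraph (a + b + 4) b` closer to `i` than to its neighbour `j`. -/
def levelCloser (a b i j : ℕ) : ℕ :=
  if level a b i < level a b j then
    level a b i + (if a + 1 < level a b i then 1 else 0) + 1
  else if level a b j < level a b i then
    (a + b + 2 - level a b i) + (if level a b i < a + 1 then 1 else 0) + 1
  else 1

lemma nCloser_Bgraph (a b : ℕ) (i j : Fin (a + b + 4)) (h : (Bgraph (a + b + 4) b).Adj i j) :
    nCloser (Bgraph (a + b + 4) b) i j = levelCloser a b i j := by
  obtain ⟨hne, h1, h2⟩ := (Bgraph_adj_iff a b i j).1 h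
  have hne' : (i : ℕ) ≠ j := fun h => hne (Fin.ext h)
  have hi := level_le a b i
  have hlevel (x y : Fin (a + b + 4)) (hxy : (x : ℕ) = y) : level a b x = level a b y := by
    rw [hxy]
  simp only [nCloser, Bgraph_dist]
  rcases lt_trichotomy (level a b i) (level a b j) with hlt | heq | hgt
  · have hset : ({w | levelDist a b i w < levelDist a b j w} : Finset (Fin (a + b + 4))) =
        insert i ({w | level a b w < level a b i} : Finset (Fin (a + b + 4))) := by
      ext w
      have := hlevel i w
      have := hlevel j w
      simp only [mem_filter_univ, mem_insert, Fin.ext_iff]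
      simp only [levelDist]
      split_ifs <;> omega
    rw [hset, card_insert_of_notMem (by simp), card_filter_level_lt a b _ hi, levelCloser,
      if_pos hlt]
  · rw [levelCloser, if_neg heq.not_lt, if_neg heq.not_gt, card_eq_one]
    refine ⟨i, ?_⟩
    ext w
    have := hlevel i w
    have := hlevel j w
    simp only [mem_filter_univ, mem_singleton, Fin.ext_iff]
    simp only [levelDist]
    split_ifs <;> omega
  · have hset : ({w | levelDist a b i w < levelDist a b j w} : Finset (Fin (a + b + 4))) =
        insert i ({w | level a b i < level a b w} : Finset (Fin (a + b + 4))) := by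
      ext w
      have := hlevel i w
      have := hlevel j w
      simp only [mem_filter_univ, mem_insert, Fin.ext_iff]
      simp only [levelDist]
      split_ifs <;> omega
    rw [hset, card_insert_of_notMem (by simp), card_filter_lt_level, levelCloser,
      if_neg hgt.not_gt, if_pos hgt]

/-- The contribution of the pair `i`, `j` to the Szeged index of `Bgraph (a + b + 4) b`. -/
def levelWeight (a b i j : ℕ) : ℚ :=
  if i ≠ j ∧ level a b i ≤ level a b j + 1 ∧ level a b j ≤ level a b i + 1 then
    (levelCloser a b i j : ℚ) * levelCloser a b j i else 0

lemma levelWeight_comm (a b i j : ℕ) : levelWeight a b i j = levelWeight a b j i := by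
  simp only [levelWeight, ne_comm (a := i), and_comm (a := level a b i ≤ level a b j + 1),
    mul_comm (levelCloser a b i j : ℚ)]

lemma sum_sum_path (m : ℕ) (F : ℕ → ℕ → ℚ) (hF : ∀ i j, F i j = F j i)
    (h0 : ∀ i j, i ≤ m → j ≤ m → i ≠ j + 1 → j ≠ i + 1 → F i j = 0) :
    ∑ i ∈ range (m + 1), ∑ j ∈ range (m + 1), F i j = 2 * ∑ i ∈ range m, F i (i + 1) := by
  induction m with
  | zero => simp [h0 0 0]
  | succ m ih =>
    have hzero : ∑ i ∈ range m, F i (m + 1) = 0 := by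
      refine sum_eq_zero fun i hi => ?_
      have := mem_range.1 hi
      exact h0 i (m + 1) (by omega) (by omega) (by omega) (by omega)
    rw [sum_range_square _ _ hF, ih fun i j hi hj => h0 i j (by omega) (by omega),
      sum_range_succ (fun i => F i (m + 1)), sum_range_succ (fun i => F i (i + 1)), hzero,
      h0 (m + 1) (m + 1) (by omega) (by omega) (by omega) (by omega)]
    ring

lemma sum_range_quadratic (m : ℕ) (p q : ℚ) :
    ∑ t ∈ range m, (p + t) * (q - t) =
      p * q * m + (q - p) * (m * (m - 1) / 2) - m * (m - 1) * (2 * m - 1) / 6 := by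
  induction m with
  | zero => simp
  | succ m ih => rw [sum_range_succ, ih]; push_cast; ring

lemma levelWeight_left {a b i : ℕ} (hi : i < a) :
    levelWeight a b i (i + 1) = (1 + i) * ((a + b + 3 : ℚ) - i) := by
  have h : a + b + 2 - (i + 1) + 1 + 1 = a + b + 3 - i := by omega
  simp only [levelWeight, levelCloser, level, show i ≠ a + b + 3 by omega,
    show i + 1 ≠ a + b + 3 by omega, show ¬ a + 1 < i by omega, show i + 1 < a + 1 by omega,
    show ¬ i + 1 < i by omega, show i < i + 1 by omega, if_true, if_false, h]
  rw [if_pos (by omega), Nat.cast_sub (by omega)]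
  push_cast
  ring

lemma levelWeight_right {a b t : ℕ} (ht : t < b) :
    levelWeight a b (a + 2 + t) (a + 2 + t + 1) = ((a + 4 : ℚ) + t) * (b - t) := by
  have h : a + b + 2 - (a + 2 + t + 1) + 0 + 1 = b - t := by omega
  simp only [levelWeight, levelCloser, level, show a + 2 + t ≠ a + b + 3 by omega,
    show a + 2 + t + 1 ≠ a + b + 3 by omega, show a + 1 < a + 2 + t by omega,
    show ¬ a + 2 + t + 1 < a + 1 by omega, show ¬ a + 2 + t + 1 < a + 2 + t by omega,
    show a + 2 + t < a + 2 + t + 1 by omega, if_true, if_false, h]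
  rw [if_pos (by omega), Nat.cast_sub (by omega)]
  push_cast
  ring

lemma levelWeight_before_twin (a b j : ℕ) (hj : j = a + 1 ∨ j = a + b + 3) :
    levelWeight a b a j = ((a : ℚ) + 1) * (b + 2) := by
  have hl : level a b j = a + 1 := by rcases hj with rfl | rfl <;> simp [level]
  have h : a + b + 2 - (a + 1) + 0 + 1 = b + 2 := by omega
  have ha : level a b a = a := if_neg (by omega)
  simp only [levelWeight, levelCloser, hl, ha, h, show ¬ a + 1 < a by omega, lt_irrefl,
    show a < a + 1 by omega, if_true, if_false]
  rw [if_pos (by omega)]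
  push_cast
  ring

lemma levelWeight_after_twin (a b j : ℕ) (hj : j = a + 1 ∨ j = a + b + 3) :
    levelWeight a b (a + 2) j = ((a : ℚ) + 2) * (b + 1) := by
  have hl : level a b j = a + 1 := by rcases hj with rfl | rfl <;> simp [level]
  have h : a + b + 2 - (a + 2) + 0 + 1 = b + 1 := by omega
  have ha : level a b (a + 2) = a + 2 := if_neg (by omega)
  simp only [levelWeight, levelCloser, hl, ha, h, show ¬ a + 2 < a + 1 by omega, lt_irrefl,
    show a + 1 < a + 2 by omega, if_true, if_false]
  rw [if_pos (by omega)]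
  push_cast
  ring

lemma levelWeight_last {a b i : ℕ} (hi : i < a + b + 3) :
    levelWeight a b i (a + b + 3) = (if i = a then ((a : ℚ) + 1) * (b + 2) else 0) +
      (if i = a + 1 then 1 else 0) + if i = a + 2 then ((a : ℚ) + 2) * (b + 1) else 0 := by
  by_cases h1 : i = a
  · subst h1
    simp [levelWeight_before_twin]
  by_cases h2 : i = a + 1
  · subst h2
    simp [levelWeight, levelCloser, level]
    omega
  by_cases h3 : i = a + 2
  · subst h3
    simp [levelWeight_after_twin]
  simp only [h1, h2, h3, if_false, add_zero, levelWeight, level, hi.ne, if_true]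
  exact if_neg (by omega)

lemma szeged_Bgraph_s15 (a b : ℕ) :
    szeged (Bgraph (a + b + 4) b) =
      wienerIndex (Bgraph (a + b + 4) b) + 2 * ((a + 1) * (b + 1)) := by
  have hw (i j : Fin (a + b + 4)) :
      (if (Bgraph (a + b + 4) b).Adj i j then
        (nCloser (Bgraph (a + b + 4) b) i j : ℚ) * (nCloser (Bgraph (a + b + 4) b) j i : ℚ)
      else 0) = levelWeight a b i j := by
    split_ifs with h
    · rw [nCloser_Bgraph a b i j h, nCloser_Bgraph a b j i h.symm, levelWeight, if_pos]
      simpa [Fin.ext_iff] using (Bgraph_adj_iff a b i j).1 h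
    · rw [levelWeight, if_neg]
      simpa [Fin.ext_iff] using (Bgraph_adj_iff a b i j).not.1 h
  rw [szeged, sum_congr rfl fun i _ => sum_congr rfl fun j _ => hw i j,
    sum_fin_symmetric (a + b + 3) (levelWeight a b) (levelWeight_comm a b),
    sum_sum_path (a + b + 2) _ (levelWeight_comm a b),
    sum_congr rfl fun i hi => levelWeight_last (a := a) (b := b) (mem_range.1 hi)]
  · rw [sum_add_distrib, sum_add_distrib, sum_ite_eq', sum_ite_eq', sum_ite_eq',
      if_pos (mem_range.2 (by omega)), if_pos (mem_range.2 (by omega)),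
      if_pos (mem_range.2 (by omega)), show a + b + 2 = a + 2 + b by ring, sum_range_add,
      sum_range_succ, sum_range_succ,
      sum_congr rfl fun i hi => levelWeight_left (b := b) (mem_range.1 hi),
      sum_congr rfl fun t ht => levelWeight_right (a := a) (mem_range.1 ht),
      levelWeight_before_twin a b (a + 1) (.inl rfl), levelWeight_comm a b (a + 1) (a + 1 + 1),
      levelWeight_after_twin a b (a + 1) (.inl rfl), sum_range_quadratic, sum_range_quadratic,
      wienerIndex_Bgraph]
    simp only [levelWeight, ne_eq, not_true, false_and, if_false]
    ring
  · intro i j hi hj h1 h2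
    simp only [levelWeight, level, show i ≠ a + b + 3 by omega, show j ≠ a + b + 3 by omega,
      if_false]
    exact if_neg (by omega)

lemma dist_map_le_of_iso {V W : Type*} {G : SimpleGraph V} {H : SimpleGraph W} (e : G ≃g H)
    (hG : G.Connected) (x y : V) : H.dist (e x) (e y) ≤ G.dist x y := by
  obtain ⟨p, hp⟩ := hG.exists_walk_length_eq_dist x y
  rw [← hp, ← SimpleGraph.Walk.length_map e.toHom p]
  exact SimpleGraph.dist_le _

lemma dist_map_of_iso {V W : Type*} {G : SimpleGraph V} {H : SimpleGraph W} (e : G ≃g H)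
    (hG : G.Connected) (x y : V) : H.dist (e x) (e y) = G.dist x y := by
  refine (dist_map_le_of_iso e hG x y).antisymm ?_
  simpa using dist_map_le_of_iso e.symm (e.connected_iff.1 hG) (e x) (e y)

lemma wienerIndex_of_iso {V W : Type*} [Fintype V] [Fintype W] {G : SimpleGraph V}
    {H : SimpleGraph W} (e : G ≃g H) (hG : G.Connected) : wienerIndex G = wienerIndex H := by
  rw [wienerIndex, wienerIndex, ← e.toEquiv.sum_comp]
  congr 1
  refine sum_congr rfl fun x _ => ?_
  rw [← e.toEquiv.sum_comp]
  exact sum_congr rfl fun y _ => by rw [← dist_map_of_iso e hG]; rfl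

lemma nCloser_of_iso {V W : Type*} [Fintype V] [Fintype W] {G : SimpleGraph V}
    {H : SimpleGraph W} (e : G ≃g H) (hG : G.Connected) (x y : V) :
    nCloser G x y = nCloser H (e x) (e y) := by
  rw [nCloser, nCloser, card_filter, card_filter, ← e.toEquiv.sum_comp]
  refine sum_congr rfl fun z _ => ?_
  rw [← dist_map_of_iso e hG, ← dist_map_of_iso e hG]
  rfl

lemma szeged_of_iso {V W : Type*} [Fintype V] [Fintype W] {G : SimpleGraph V}
    {H : SimpleGraph W} (e : G ≃g H) (hG : G.Connected) : szeged G = szeged H := by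
  rw [szeged, szeged, ← e.toEquiv.sum_comp]
  congr 1
  refine sum_congr rfl fun x _ => ?_
  rw [← e.toEquiv.sum_comp]
  refine sum_congr rfl fun y _ => ?_
  rw [nCloser_of_iso e hG, nCloser_of_iso e hG]
  exact if_congr e.map_adj_iff.symm rfl rfl

/-- Reversing the long path of `Bgraph (a + b + 4) b` exchanges the two tails. -/
lemma nonempty_Bgraph_iso_reverse (n a b : ℕ) (h : a + b + 4 = n) :
    Nonempty (Bgraph n b ≃g Bgraph n a) := by
  let f : Fin n → Fin n := fun i => ⟨if (i : ℕ) = n - 1 then n - 1 else n - 2 - i, by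
    split_ifs <;> omega⟩
  have hf : Function.Involutive f := by
    intro i
    have := i.isLt
    simp only [f, Fin.ext_iff]
    split_ifs <;> omega
  have hlevel (i : Fin n) : level b a (f i) + level a b i = a + b + 2 := by
    have := i.isLt
    simp only [level, f]
    split_ifs <;> omega
  refine ⟨hf.toPerm, ?_⟩
  intro i j
  have hi := hlevel i
  have hj := hlevel j
  rw [Function.Involutive.coe_toPerm, Bgraph_adj_iff_of_eq h,
    Bgraph_adj_iff_of_eq (show b + a + 4 = n by omega), hf.injective.ne_iff]
  exact and_congr_right fun _ => by omega

lemma dist_getVert_of_length_eq_dist {V : Type*} {G : SimpleGraph V} (hG : G.Connected) {u w : V}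
    (p : G.Walk u w) (hp : p.length = G.dist u w) (i : ℕ) {j : ℕ}
    (hj : j ≤ p.length) :
    j ≤ G.dist (p.getVert i) (p.getVert j) + i := by
  have h1 := SimpleGraph.dist_le (p.take i)
  have h2 := SimpleGraph.dist_le (p.drop j)
  have h3 := hG.dist_triangle (u := u) (v := p.getVert i) (w := w)
  have h4 := hG.dist_triangle (u := p.getVert i) (v := p.getVert j) (w := w)
  rw [SimpleGraph.Walk.take_length] at h1
  rw [SimpleGraph.Walk.drop_length] at h2
  omega

lemma sum_sum_adj {V : Type*} [Fintype V] (G : SimpleGraph V) :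
    ∑ x : V, ∑ y : V, (if G.Adj x y then (1 : ℚ) else 0) = 2 * G.edgeSet.ncard := by
  have h := G.sum_degrees_eq_twice_card_edges
  rw [← SimpleGraph.coe_edgeFinset, Set.ncard_coe_finset]
  exact_mod_cast (by
    rw [← h]
    refine sum_congr rfl fun x _ => ?_
    rw [← card_filter, ← SimpleGraph.card_neighborFinset_eq_degree,
      SimpleGraph.neighborFinset_eq_filter] :
    ∑ x : V, ∑ y : V, (if G.Adj x y then 1 else 0) = 2 * #G.edgeFinset)

lemma exists_iso_Bgraph {V : Type*} [Fintype V] (G : SimpleGraph V) (m : ℕ)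
    (hcard : Fintype.card V = m + 4) (hG : G.Connected) (hedge : G.edgeSet.ncard = m + 5)
    (u w : V) (huw : G.dist u w = m + 2) :
    ∃ a b, a + b = m ∧ Nonempty (G ≃g Bgraph (m + 4) b) := by
  obtain ⟨p, hp⟩ := hG.exists_walk_length_eq_dist u w
  have hlen : p.length = m + 2 := hp.trans huw
  have hdist (i : ℕ) {j : ℕ} (hj : j < m + 3) :=
    dist_getVert_of_length_eq_dist hG p hp i (j := j) (by omega)
  have hinj {i j : ℕ} (hi : i < m + 3) (hj : j < m + 3) (h : p.getVert i = p.getVert j) :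
      i = j := by
    have h1 := hdist i hj
    have h2 := hdist j hi
    rw [h, SimpleGraph.dist_self] at h1 h2
    omega
  have hadj {i j : ℕ} (hi : i < m + 3) (hj : j < m + 3) :
      G.Adj (p.getVert i) (p.getVert j) ↔ j = i + 1 ∨ i = j + 1 := by
    constructor
    · intro h
      have h1 := SimpleGraph.dist_eq_one_iff_adj.2 h
      have hne : i ≠ j := fun hij => h.ne (by rw [hij])
      have h2 := hdist i hj
      have h3 := hdist j hi
      rw [SimpleGraph.dist_comm] at h3
      omega
    · rintro (rfl | rfl)
      · exact p.adj_getVert_succ (by omega)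
      · exact (p.adj_getVert_succ (by omega)).symm
  obtain ⟨v, hv⟩ : ∃ v, v ∉ (range (m + 3)).image p.getVert := by
    by_contra! h
    have h1 := card_le_card (fun x _ => h x : (univ : Finset V) ⊆ _)
    have h2 := (card_image_le : #((range (m + 3)).image p.getVert) ≤ _)
    rw [card_univ, hcard] at h1
    rw [card_range] at h2
    omega
  have hv' {i : ℕ} (hi : i < m + 3) : p.getVert i ≠ v :=
    fun h => hv (mem_image.2 ⟨i, mem_range.2 hi, h⟩)
  set f : ℕ → V := fun i => if i = m + 3 then v else p.getVert i with hf
  have hf1 {i : ℕ} (hi : i < m + 3) : f i = p.getVert i := if_neg hi.ne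
  have hf2 : f (m + 3) = v := if_pos rfl
  have hbij : Function.Bijective fun i : Fin (m + 4) => f i := by
    rw [Fintype.bijective_iff_injective_and_card]
    refine ⟨fun i j hij => ?_, by simp [hcard]⟩
    have hi := i.isLt
    have hj := j.isLt
    simp only [hf] at hij
    ext
    split_ifs at hij
    · omega
    · exact absurd hij.symm (hv' (by omega))
    · exact absurd hij (hv' (by omega))
    · exact hinj (by omega) (by omega) hij
  let e : Fin (m + 4) ≃ V := Equiv.ofBijective _ hbij
  have hsum := sum_sum_adj G
  rw [← e.sum_comp, sum_congr rfl fun i _ => (e.sum_comp _).symm] at hsum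
  have hsymm (i j : ℕ) : (if G.Adj (f i) (f j) then (1 : ℚ) else 0) =
      if G.Adj (f j) (f i) then 1 else 0 := if_congr (G.adj_comm _ _) rfl rfl
  have hsplit := (sum_fin_symmetric (m + 3) _ hsymm).symm.trans hsum
  rw [sum_sum_path (m + 2) _ hsymm, sum_congr rfl (g := fun _ => 1), hedge, sum_boole] at hsplit
  rotate_left
  · intro i hi
    have hi := mem_range.1 hi
    rw [hf1 (by omega), hf1 (by omega), if_pos ((hadj (by omega) (by omega)).2 (.inl rfl))]
  · intro i j hi hj h1 h2
    rw [hf1 (by omega), hf1 (by omega), if_neg]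
    rw [hadj (by omega) (by omega)]
    omega
  set T := (range (m + 3)).filter fun i => G.Adj (f i) (f (m + 3)) with hT
  have hTcard : #T = 3 := by
    simp only [sum_const, card_range, SimpleGraph.irrefl, if_false, nsmul_eq_mul] at hsplit
    push_cast at hsplit
    exact_mod_cast (by linarith : (#T : ℚ) = 3)
  have hTmem {i : ℕ} : i ∈ T ↔ i < m + 3 ∧ G.Adj (p.getVert i) v := by
    rw [hT, mem_filter, mem_range, hf2]
    exact and_congr_right fun hi => by rw [hf1 hi]
  have hTne : T.Nonempty := card_pos.1 (by omega)
  obtain ⟨k, hk⟩ : ∃ k, k = T.min' hTne := ⟨_, rfl⟩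
  have hkT := hTmem.1 (hk ▸ T.min'_mem hTne)
  have hTIcc : T = Icc k (k + 2) := by
    refine eq_of_subset_of_card_le (fun i hi => ?_) (by rw [hTcard, Nat.card_Icc]; omega)
    have hki : k ≤ i := hk ▸ T.min'_le i hi
    have hi := hTmem.1 hi
    have h1 := hdist k hi.1
    have h2 := hG.dist_triangle (u := p.getVert k) (v := v) (w := p.getVert i)
    rw [SimpleGraph.dist_eq_one_iff_adj.2 hkT.2, SimpleGraph.dist_eq_one_iff_adj.2 hi.2.symm] at h2
    rw [mem_Icc]
    omega
  have hkm : k + 2 < m + 3 := (hTmem.1 (hTIcc ▸ mem_Icc.2 ⟨by omega, le_rfl⟩)).1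
  have hadjv {i : ℕ} (hi : i < m + 3) : G.Adj (p.getVert i) v ↔ k ≤ i ∧ i ≤ k + 2 := by
    rw [← mem_Icc, ← hTIcc, hTmem]
    exact (and_iff_right hi).symm
  refine ⟨k, m - k, by omega, ⟨(⟨e, ?_⟩ : Bgraph (m + 4) (m - k) ≃g G).symm⟩⟩
  intro i j
  change G.Adj (f i) (f j) ↔ _
  have hi := i.isLt
  have hj := j.isLt
  simp only [Bgraph, SimpleGraph.fromRel_adj, ne_eq, Fin.ext_iff]
  by_cases hi' : (i : ℕ) = m + 3 <;> by_cases hj' : (j : ℕ) = m + 3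
  · exact iff_of_false (by rw [hi', hj']; exact G.irrefl) (fun h => h.1 (hi'.trans hj'.symm))
  · rw [hi', hf2, hf1 (by omega), G.adj_comm, hadjv (by omega)]
    omega
  · rw [hj', hf2, hf1 (by omega), hadjv (by omega)]
    omega
  · rw [hf1 (by omega), hf1 (by omega), hadj (by omega) (by omega)]
    omega

/-- For a bicyclic graph of order `n ≥ 5` with diameter `n - 2`,
`Sz(G)/W(G) ≥ 1 + 12(n-3)/(n³ - 13n + 30)`, with equality iff `G ≅ B(n,0)`. -/
theorem szeged_div_wiener_bicyclic_diameter
    {V : Type*} [Fintype V] (G : SimpleGraph V) (n : ℕ)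
    (hcard : Fintype.card V = n) (hn : 5 ≤ n)
    (hconn : G.Connected) (hbic : G.edgeSet.ncard = n + 1)
    (hdiam_le : ∀ u w : V, G.dist u w ≤ n - 2)
    (hdiam_eq : ∃ u w : V, G.dist u w = n - 2) :
    1 + 12 * ((n : ℚ) - 3) / ((n : ℚ) ^ 3 - 13 * n + 30) ≤ szeged G / wienerIndex G ∧
    (szeged G / wienerIndex G = 1 + 12 * ((n : ℚ) - 3) / ((n : ℚ) ^ 3 - 13 * n + 30) ↔
      Nonempty (G ≃g Bgraph n 0)) := by
  obtain ⟨u, w, huw⟩ := hdiam_eq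
  obtain ⟨m, rfl⟩ : ∃ m, n = m + 4 := ⟨n - 4, by omega⟩
  obtain ⟨a, b, hab, ⟨e⟩⟩ := exists_iso_Bgraph G m hcard hconn hbic u w huw
  subst hab
  have key {b' a' : ℕ} (h : a' + b' = a + b) (e' : G ≃g Bgraph (a + b + 4) b') :
      wienerIndex G = (((a : ℚ) + b + 4) ^ 3 - 13 * (a + b + 4) + 30) / 6 - a' * b' ∧
      szeged G = wienerIndex G + 2 * ((a' + 1) * (b' + 1)) := by
    have hq : (a' : ℚ) + b' = a + b := by exact_mod_cast h
    rw [szeged_of_iso e' hconn, wienerIndex_of_iso e' hconn, ← h, ← hq]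
    exact ⟨wienerIndex_Bgraph a' b', szeged_Bgraph_s15 a' b'⟩
  obtain ⟨hW, hS⟩ := key rfl e
  have hab1 : (1 : ℚ) ≤ a + b := by exact_mod_cast (by omega : 1 ≤ a + b)
  have ha : (0 : ℚ) ≤ a := Nat.cast_nonneg a
  have hb : (0 : ℚ) ≤ b := Nat.cast_nonneg b
  have ht : 0 ≤ (a : ℚ) * b := mul_nonneg ha hb
  have hWpos : 0 < wienerIndex G := by
    rw [hW]
    nlinarith [mul_nonneg ha ha, mul_nonneg hb hb, mul_nonneg ht ha, mul_nonneg ht hb,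
      pow_nonneg ha 3, pow_nonneg hb 3]
  set D : ℚ := ((a : ℚ) + b + 4) ^ 3 - 13 * (a + b + 4) + 30 with hD
  have hDpos : 0 < D := by linarith
  have hdiff : szeged G / wienerIndex G - (1 + 12 * (a + b + 1) / D) =
      a * b * (2 * D + 12 * (a + b + 1)) / (wienerIndex G * D) := by
    have hD' : D = 6 * (wienerIndex G + a * b) := by linarith
    have h0 : wienerIndex G + a * b ≠ 0 := by positivity
    rw [hS, hD']
    field_simp
    ring
  have hcast : 1 + 12 * (((a + b + 4 : ℕ) : ℚ) - 3) /
      (((a + b + 4 : ℕ) : ℚ) ^ 3 - 13 * ((a + b + 4 : ℕ) : ℚ) + 30) =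
      1 + 12 * (a + b + 1) / D := by
    rw [hD]
    push_cast
    ring
  rw [hcast]
  refine ⟨sub_nonneg.1 (hdiff ▸ by positivity), ?_, ?_⟩
  · intro h
    rw [h, sub_self, eq_comm, div_eq_zero_iff] at hdiff
    have h0 : (a : ℚ) * b = 0 := by
      rcases hdiff with h | h
      · exact (mul_eq_zero.1 h).resolve_right (by positivity)
      · exact absurd h (by positivity)
    rcases mul_eq_zero.1 h0 with h | h
    · obtain rfl : a = 0 := by exact_mod_cast h
      obtain ⟨r⟩ := nonempty_Bgraph_iso_reverse (0 + b + 4) 0 b rfl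
      exact ⟨e.trans r⟩
    · obtain rfl : b = 0 := by exact_mod_cast h
      exact ⟨e⟩
  · rintro ⟨e'⟩
    obtain ⟨hW', hS'⟩ := key (a' := a + b) (b' := 0) rfl e'
    have hW'' : wienerIndex G = D / 6 := by simpa using hW'
    rw [hS', hW'']
    push_cast
    field_simp
    ring
end
end

section
/- Let G be a unicyclic graph on n ≥ 4 vertices. Then W(G) ≤ W(L_{n,3}) = (n³ − 7n + 12)/6. -/
open SimpleGraph Finset
open scoped Classical

noncomputable section

section LevelFunctions

variable {α : Type*} {s : Finset α} {f : α → ℕ}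

/-- If the values of `f` on `s` form an initial segment of `ℕ`, they are less than `#s`. -/
theorem lt_card_of_values_initial (hf : ∀ x ∈ s, ∀ k < f x, ∃ y ∈ s, f y = k) {x : α}
    (hx : x ∈ s) : f x < #s := by
  have hsub : range (f x + 1) ⊆ s.image f := by
    intro k hk
    rcases (Nat.lt_succ_iff.mp (mem_range.mp hk)).lt_or_eq with h | rfl
    · obtain ⟨y, hy, rfl⟩ := hf x hx k h
      exact mem_image_of_mem f hy
    · exact mem_image_of_mem f hx
  have h := (card_le_card hsub).trans card_image_le
  rw [card_range] at h
  omega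

theorem sum_le_of_values_initial (hf : ∀ x ∈ s, ∀ k < f x, ∃ y ∈ s, f y = k) :
    ∑ x ∈ s, (f x : ℚ) ≤ (#s : ℚ) * (#s - 1) / 2 := by
  induction hc : #s generalizing s with
  | zero => simp [card_eq_zero.mp hc]
  | succ c ih =>
    obtain ⟨x, hx, hmax⟩ := exists_max_image s f (card_pos.mp (by omega))
    have herase : #(s.erase x) = c := by rw [card_erase_of_mem hx, hc]; rfl
    have hsum := ih (s := s.erase x) (fun y hy k hk => by
      have hy' := mem_of_mem_erase hy
      obtain ⟨z, hz, hzk⟩ := hf y hy' k hk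
      have := hmax y hy'
      refine ⟨z, mem_erase.mpr ⟨?_, hz⟩, hzk⟩
      rintro rfl
      omega) herase
    have hlt : f x ≤ c := by
      have := lt_card_of_values_initial hf hx
      omega
    have hltQ : (f x : ℚ) ≤ c := by exact_mod_cast hlt
    rw [← add_sum_erase s _ hx]
    push_cast
    linarith

/-- A repeated value improves the bound of `sum_le_of_values_initial`. -/
theorem sum_le_of_values_initial_of_eq (hf : ∀ x ∈ s, ∀ k < f x, ∃ y ∈ s, f y = k) {a b : α}
    (ha : a ∈ s) (hb : b ∈ s) (hab : a ≠ b) (hfab : f a = f b) :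
    ∑ x ∈ s, (f x : ℚ) ≤ ((#s : ℚ) - 1) * (#s - 2) / 2 + f b ∧ (f b : ℚ) ≤ #s - 2 := by
  have hf' : ∀ x ∈ s.erase b, ∀ k < f x, ∃ y ∈ s.erase b, f y = k := by
    intro x hx k hk
    obtain ⟨y, hy, hyk⟩ := hf x (mem_of_mem_erase hx) k hk
    by_cases hyb : y = b
    · exact ⟨a, mem_erase.mpr ⟨hab, ha⟩, by rw [hfab, ← hyb, hyk]⟩
    · exact ⟨y, mem_erase.mpr ⟨hyb, hy⟩, hyk⟩
  have hcard : ((#(s.erase b) : ℕ) : ℚ) = #s - 1 := by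
    rw [card_erase_of_mem hb, Nat.cast_pred (card_pos.mpr ⟨b, hb⟩)]
  have hlt := lt_card_of_values_initial hf' (mem_erase.mpr ⟨hab, ha⟩)
  have hltQ : (f b : ℚ) + 1 ≤ #(s.erase b) := by
    rw [← hfab]
    exact_mod_cast hlt
  have hsum := sum_le_of_values_initial hf'
  rw [← add_sum_erase s _ hb]
  rw [hcard] at hsum hltQ
  constructor <;> linarith

end LevelFunctions

section Distances

variable {V : Type*} {G : SimpleGraph V}

theorem SimpleGraph.Connected.exists_adj_dist_eq (hG : G.Connected) {u v : V} {k : ℕ}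
    (h : G.dist u v = k + 1) : ∃ w, G.Adj u w ∧ G.dist w v = k := by
  obtain ⟨p, hp⟩ := hG.exists_walk_length_eq_dist u v
  cases p with
  | nil => simp at h
  | @cons _ w _ hadj q =>
    refine ⟨w, hadj, ?_⟩
    have h₁ := dist_le q
    have h₂ := hG.dist_triangle (u := u) (v := w) (w := v)
    rw [dist_eq_one_iff_adj.mpr hadj] at h₂
    rw [Walk.length_cons] at hp
    omega

theorem SimpleGraph.Connected.exists_dist_eq_of_lt (hG : G.Connected) {u v : V} {k : ℕ}
    (h : k < G.dist u v) : ∃ w, G.dist w v = k := by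
  induction hm : G.dist u v generalizing u with
  | zero => omega
  | succ m ih =>
    obtain ⟨w, -, hw⟩ := hG.exists_adj_dist_eq hm
    rcases (show k ≤ m by omega).lt_or_eq with hk | rfl
    · exact ih (hw ▸ hk) hw
    · exact ⟨w, hw⟩

variable [Fintype V]

theorem transmission_le (hG : G.Connected) (v : V) :
    transmission G v ≤ (Fintype.card V : ℚ) * (Fintype.card V - 1) / 2 :=
  sum_le_of_values_initial (s := univ) (f := fun x => G.dist x v) fun _ _ _ hk =>
    let ⟨w, hw⟩ := hG.exists_dist_eq_of_lt hk
    ⟨w, mem_univ w, hw⟩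

theorem transmission_le_of_dist_eq (hG : G.Connected) {a b v : V} (hab : a ≠ b)
    (h : G.dist a v = G.dist b v) :
    transmission G v ≤ ((Fintype.card V : ℚ) - 1) * (Fintype.card V - 2) / 2 + G.dist b v ∧
      (G.dist b v : ℚ) ≤ Fintype.card V - 2 :=
  sum_le_of_values_initial_of_eq (s := univ) (f := fun x => G.dist x v)
    (fun _ _ _ hk =>
      let ⟨w, hw⟩ := hG.exists_dist_eq_of_lt hk
      ⟨w, mem_univ w, hw⟩)
    (mem_univ a) (mem_univ b) hab h

/-- A connected graph in which the distances from some vertex are pairwise distinct is a path,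
hence has fewer edges than vertices. -/
theorem ncard_edgeSet_lt_card_of_injective_dist (hG : G.Connected) {v : V}
    (hinj : Function.Injective fun x => G.dist x v) : G.edgeSet.ncard < Fintype.card V := by
  have hpar : ∀ x, ∃ y, x ≠ v → G.Adj x y ∧ G.dist x v = G.dist y v + 1 := by
    intro x
    by_cases hx : x = v
    · exact ⟨v, fun h => absurd hx h⟩
    · obtain ⟨k, hk⟩ := Nat.exists_eq_succ_of_ne_zero (hG.pos_dist_of_ne hx).ne'
      obtain ⟨y, hy, hyk⟩ := hG.exists_adj_dist_eq hk
      exact ⟨y, fun _ => ⟨hy, by omega⟩⟩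
  choose p hp using hpar
  have hedge : ∀ a b, G.Adj a b → G.dist a v < G.dist b v →
      s(a, b) ∈ (fun x => s(p x, x)) '' ({v}ᶜ : Set V) := by
    intro a b hadj hlt
    have hb : b ≠ v := by
      rintro rfl
      simp at hlt
    have h₁ := hG.dist_triangle (u := b) (v := a) (w := v)
    rw [dist_eq_one_iff_adj.mpr hadj.symm] at h₁
    have h₂ := (hp b hb).2
    have hpb : p b = a := hinj (show G.dist (p b) v = G.dist a v by omega)
    exact ⟨b, hb, by simp [hpb]⟩
  have hsub : G.edgeSet ⊆ (fun x => s(p x, x)) '' ({v}ᶜ : Set V) := by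
    intro e
    induction e using Sym2.ind with
    | _ a b =>
      intro hadj
      rw [mem_edgeSet] at hadj
      rcases lt_or_gt_of_ne (fun h => hadj.ne (hinj h) : G.dist a v ≠ G.dist b v) with h | h
      · exact hedge a b hadj h
      · exact Sym2.eq_swap ▸ hedge b a hadj.symm h
  calc G.edgeSet.ncard ≤ ({v}ᶜ : Set V).ncard :=
        (Set.ncard_le_ncard hsub).trans (Set.ncard_image_le)
    _ < Fintype.card V := by
        have := Set.ncard_add_ncard_compl ({v} : Set V)
        rw [Set.ncard_singleton, Nat.card_eq_fintype_card] at this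
        omega

theorem transmission_le_of_card_le_ncard_edgeSet (hG : G.Connected)
    (he : Fintype.card V ≤ G.edgeSet.ncard) (v : V) :
    transmission G v ≤ (Fintype.card V : ℚ) * (Fintype.card V - 1) / 2 - 1 := by
  have hninj : ¬ Function.Injective fun x => G.dist x v := fun h =>
    (ncard_edgeSet_lt_card_of_injective_dist hG h).not_ge he
  obtain ⟨a, b, hfab, hab⟩ := Function.not_injective_iff.mp hninj
  obtain ⟨h₁, h₂⟩ := transmission_le_of_dist_eq hG hab hfab
  linarith

end Distances

section VertexDeletion

variable {V : Type*} [Fintype V] {G : SimpleGraph V} {x : V}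

theorem card_compl_singleton_add_one (x : V) :
    Fintype.card ({x}ᶜ : Set V) + 1 = Fintype.card V := by
  have := Set.ncard_add_ncard_compl ({x} : Set V)
  rw [Set.ncard_singleton, Nat.card_eq_fintype_card, ← Nat.card_coe_set_eq,
    Nat.card_eq_fintype_card] at this
  omega

theorem wienerIndex_le_induce_compl_singleton_add (hx : (G.induce {x}ᶜ).Connected) :
    wienerIndex G ≤ wienerIndex (G.induce {x}ᶜ) + transmission G x := by
  have hdist : ∀ u v : ({x}ᶜ : Set V), G.dist u v ≤ (G.induce {x}ᶜ).dist u v := by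
    intro u v
    obtain ⟨p, hp⟩ := hx.exists_walk_length_eq_dist u v
    rw [← hp, ← Walk.length_map (Embedding.induce ({x}ᶜ : Set V)).toHom p]
    exact dist_le _
  have hsplit : ∀ f : V → ℚ, ∑ u, f u = f x + ∑ u : ({x}ᶜ : Set V), f u := by
    intro f
    rw [← add_sum_erase univ f (mem_univ x)]
    congr 1
    exact sum_subtype _ (by simp) f
  have htrans : transmission G x = ∑ u : ({x}ᶜ : Set V), (G.dist u x : ℚ) := by
    rw [transmission, hsplit]
    simp
  have hsum : ∑ u : ({x}ᶜ : Set V), ∑ v : ({x}ᶜ : Set V), (G.dist u v : ℚ) ≤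
      ∑ u, ∑ v, ((G.induce {x}ᶜ).dist u v : ℚ) :=
    sum_le_sum fun u _ => sum_le_sum fun v _ => by exact_mod_cast hdist u v
  have hG : ∑ u, ∑ v, (G.dist u v : ℚ) =
      2 * transmission G x +
        ∑ u : ({x}ᶜ : Set V), ∑ v : ({x}ᶜ : Set V), (G.dist u v : ℚ) := by
    rw [hsplit]
    simp_rw [hsplit (fun v => (G.dist _ v : ℚ)), sum_add_distrib]
    rw [htrans]
    simp_rw [dist_comm (u := x), dist_self]
    push_cast
    ring
  rw [wienerIndex, wienerIndex, hG]
  linarith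

/-- Deleting a vertex with at most one neighbour deletes at most one edge. -/
theorem ncard_edgeSet_le_induce_compl_singleton_add_one
    (h : ∀ a b, G.Adj x a → G.Adj x b → a = b) :
    G.edgeSet.ncard ≤ (G.induce {x}ᶜ).edgeSet.ncard + 1 := by
  have hstar : (G.incidenceSet x).ncard ≤ 1 := by
    rw [Set.ncard_le_one]
    intro e he e' he'
    obtain ⟨a, rfl⟩ := Sym2.mem_iff_exists.mp he.2
    obtain ⟨b, rfl⟩ := Sym2.mem_iff_exists.mp he'.2
    rw [h a b he.1 he'.1]
  have hsub : G.edgeSet ⊆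
      Sym2.map Subtype.val '' (G.induce {x}ᶜ).edgeSet ∪ G.incidenceSet x := by
    intro e
    induction e using Sym2.ind with
    | _ a b =>
      intro hadj
      by_cases hxe : x ∈ s(a, b)
      · exact Or.inr ⟨hadj, hxe⟩
      · rw [Sym2.mem_iff, not_or] at hxe
        exact Or.inl ⟨s(⟨a, Ne.symm hxe.1⟩, ⟨b, Ne.symm hxe.2⟩), hadj, rfl⟩
  calc G.edgeSet.ncard ≤ _ := Set.ncard_le_ncard hsub
    _ ≤ _ := Set.ncard_union_le _ _
    _ ≤ _ := add_le_add Set.ncard_image_le hstar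

end VertexDeletion

/-- Among connected graphs on a given number of vertices, the path maximizes the Wiener index. -/
theorem wienerIndex_le_of_connected {V : Type*} [Fintype V] {G : SimpleGraph V}
    (hG : G.Connected) :
    wienerIndex G ≤ ((Fintype.card V : ℚ) ^ 3 - Fintype.card V) / 6 := by
  induction hc : Fintype.card V using Nat.strong_induction_on generalizing V with
  | _ n ih =>
    rcases subsingleton_or_nontrivial V with hV | hV
    · have := hG.nonempty
      have hn : n = 1 :=
        hc ▸ le_antisymm (Fintype.card_le_one_iff_subsingleton.mpr hV) Fintype.card_pos
      have hzero : ∀ u v, G.dist u v = 0 := fun u v => by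
        rw [Subsingleton.elim u v, SimpleGraph.dist_self]
      simp [wienerIndex, hzero, hn]
    · obtain ⟨x, hx⟩ := hG.exists_connected_induce_compl_singleton_of_finite_nontrivial
      have hcard := card_compl_singleton_add_one x
      have hind := ih _ (by omega) hx rfl
      have hdel := wienerIndex_le_induce_compl_singleton_add hx
      have htrans := transmission_le hG x
      have hcardQ : (Fintype.card ({x}ᶜ : Set V) : ℚ) = n - 1 := by
        rw [eq_sub_iff_add_eq, ← hc]
        exact_mod_cast hcard
      rw [hcardQ] at hind
      rw [hc] at htrans
      linarith

theorem wienerIndex_le_of_card_le_ncard_edgeSet {V : Type*} [Fintype V] {G : SimpleGraph V}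
    (hG : G.Connected) (he : Fintype.card V ≤ G.edgeSet.ncard) :
    wienerIndex G ≤ ((Fintype.card V : ℚ) ^ 3 - 7 * Fintype.card V + 12) / 6 := by
  induction hc : Fintype.card V using Nat.strong_induction_on generalizing V with
  | _ n ih =>
    have hV : Nontrivial V := by
      by_contra hV
      rw [not_nontrivial_iff_subsingleton] at hV
      have := hG.nonempty
      have hbot : G.edgeSet = ∅ := by rw [Subsingleton.elim G ⊥, edgeSet_bot]
      rw [hbot, Set.ncard_empty] at he
      exact Fintype.card_ne_zero (Nat.le_zero.mp he)
    obtain ⟨x, hx⟩ := hG.exists_connected_induce_compl_singleton_of_finite_nontrivial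
    have hcard := card_compl_singleton_add_one x
    have hdel := wienerIndex_le_induce_compl_singleton_add hx
    have hcardQ : (Fintype.card ({x}ᶜ : Set V) : ℚ) = n - 1 := by
      rw [eq_sub_iff_add_eq, ← hc]
      exact_mod_cast hcard
    by_cases hleaf : ∀ a b, G.Adj x a → G.Adj x b → a = b
    · have hedges := ncard_edgeSet_le_induce_compl_singleton_add_one hleaf
      have hind := ih _ (by omega) hx (by omega) rfl
      have htrans := transmission_le_of_card_le_ncard_edgeSet hG he x
      rw [hcardQ] at hind
      rw [hc] at htrans
      linarith
    · push Not at hleaf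
      obtain ⟨a, b, ha, hb, hab⟩ := hleaf
      have hdb : G.dist b x = 1 := dist_eq_one_iff_adj.mpr hb.symm
      have htrans := (transmission_le_of_dist_eq hG (v := x) hab
        ((dist_eq_one_iff_adj.mpr ha.symm).trans hdb.symm)).1
      have htree := wienerIndex_le_of_connected hx
      rw [hcardQ] at htree
      rw [hc, hdb] at htrans
      push_cast at htrans
      linarith

section Lollipop

/-- The distance between the vertices `i` and `j` of a lollipop with a triangle. -/
def lollipopThreeDist (i j : ℕ) : ℕ :=
  if i = j then 0 else max 1 (max i j - max 1 (min i j))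

theorem lollipop_three_adj {n : ℕ} {a b : Fin n} :
    (lollipop n 3).Adj a b ↔ a.val + 1 = b.val ∨ b.val + 1 = a.val ∨
      (a.val = 0 ∧ b.val = 2) ∨ (b.val = 0 ∧ a.val = 2) := by
  rw [lollipop, fromRel_adj, ne_eq, Fin.ext_iff]
  omega

theorem exists_walk_lollipop_three {n : ℕ} {a b : Fin n} (hab : a ≤ b) :
    ∃ p : (lollipop n 3).Walk a b, p.length = b.val - a.val := by
  induction hk : b.val - a.val generalizing a with
  | zero =>
    obtain rfl : a = b := Fin.ext (by have : a.val ≤ b.val := hab; omega)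
    exact ⟨Walk.nil, rfl⟩
  | succ k ih =>
    have hadj : (lollipop n 3).Adj a ⟨a.val + 1, by omega⟩ :=
      lollipop_three_adj.mpr (Or.inl rfl)
    obtain ⟨p, hp⟩ := ih (a := ⟨a.val + 1, by omega⟩)
      (by rw [Fin.le_def]; simp only; omega) (by simp only; omega)
    exact ⟨Walk.cons hadj p, by rw [Walk.length_cons, hp]⟩

/-- A function changing by at most one along edges changes by at most the length along walks. -/
theorem SimpleGraph.Walk.le_add_length {V : Type*} {G : SimpleGraph V} {φ : V → ℕ}
    (hφ : ∀ a b, G.Adj a b → φ b ≤ φ a + 1) {a b : V} (p : G.Walk a b) :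
    φ b ≤ φ a + p.length := by
  induction p with
  | nil => simp
  | cons h q ih =>
    have := hφ _ _ h
    rw [Walk.length_cons]
    omega

theorem dist_lollipop_three_of_lt {n : ℕ} {a b : Fin n} (hab : a < b) :
    (lollipop n 3).dist a b = lollipopThreeDist a b := by
  have hlt : a.val < b.val := hab
  obtain ⟨p, hp⟩ := exists_walk_lollipop_three hab.le
  have hpos := Reachable.pos_dist_of_ne ⟨p⟩ hab.ne
  have hup := dist_le p
  obtain ⟨q, hq⟩ := Reachable.exists_walk_length_eq_dist ⟨p⟩
  have h₁ := q.le_add_length (φ := fun c => max 1 c.val) fun c d h => by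
    rw [lollipop_three_adj] at h
    omega
  have h₂ := q.le_add_length (φ := fun c => c.val - 1) fun c d h => by
    rw [lollipop_three_adj] at h
    omega
  have h₃ : a.val = 0 → 2 ≤ b.val → (lollipop n 3).dist a b ≤ b.val - 1 := by
    intro ha hb
    have hadj : (lollipop n 3).Adj a ⟨2, by omega⟩ :=
      lollipop_three_adj.mpr (Or.inr (Or.inr (Or.inl ⟨ha, rfl⟩)))
    obtain ⟨r, hr⟩ := exists_walk_lollipop_three (a := ⟨2, by omega⟩) (b := b) hb
    have := dist_le (Walk.cons hadj r)
    rw [Walk.length_cons, hr] at this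
    simp only at this
    omega
  rw [lollipopThreeDist, if_neg hlt.ne]
  omega

theorem lollipopThreeDist_comm (i j : ℕ) : lollipopThreeDist i j = lollipopThreeDist j i := by
  simp only [lollipopThreeDist, eq_comm (a := i), max_comm i, min_comm i]

theorem dist_lollipop_three {n : ℕ} (a b : Fin n) :
    (lollipop n 3).dist a b = lollipopThreeDist a b := by
  rcases lt_trichotomy a b with h | rfl | h
  · exact dist_lollipop_three_of_lt h
  · simp [lollipopThreeDist]
  · rw [dist_comm, lollipopThreeDist_comm, dist_lollipop_three_of_lt h]

theorem sum_range_lollipopThreeDist {n m : ℕ} (hn : 2 ≤ n) (hm : m < n) :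
    ∑ i ∈ range (m + 1), (lollipopThreeDist i n : ℚ) = n - 1 + m * n - m * (m + 1) / 2 := by
  induction m with
  | zero =>
    have h : lollipopThreeDist 0 n + 1 = n := by
      rw [lollipopThreeDist, if_neg (by omega)]
      omega
    have hQ : (lollipopThreeDist 0 n : ℚ) + 1 = n := by exact_mod_cast h
    simp
    linarith
  | succ m ih =>
    have h : lollipopThreeDist (m + 1) n + (m + 1) = n := by
      rw [lollipopThreeDist, if_neg (by omega)]
      omega
    have hQ : (lollipopThreeDist (m + 1) n : ℚ) + (m + 1) = n := by exact_mod_cast h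
    rw [sum_range_succ, ih (by omega)]
    push_cast
    linarith

theorem sum_sum_range_lollipopThreeDist {n : ℕ} (hn : 2 ≤ n) :
    ∑ i ∈ range n, ∑ j ∈ range n, (lollipopThreeDist i j : ℚ) =
      ((n : ℚ) ^ 3 - 7 * n + 12) / 3 := by
  induction n, hn using Nat.le_induction with
  | base => norm_num [sum_range_succ, lollipopThreeDist]
  | succ n hn ih =>
    have hrow := sum_range_lollipopThreeDist (m := n - 1) hn (by omega)
    rw [Nat.sub_add_cancel (by omega), Nat.cast_pred (by omega)] at hrow
    have hdiag : lollipopThreeDist n n = 0 := if_pos rfl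
    simp_rw [sum_range_succ, sum_add_distrib]
    simp_rw [lollipopThreeDist_comm n]
    rw [ih, hrow, hdiag]
    push_cast
    ring

theorem wienerIndex_lollipop_three {n : ℕ} (hn : 2 ≤ n) :
    wienerIndex (lollipop n 3) = ((n : ℚ) ^ 3 - 7 * n + 12) / 6 := by
  have hsum := sum_sum_range_lollipopThreeDist hn
  simp_rw [← Fin.sum_univ_eq_sum_range] at hsum
  simp_rw [wienerIndex, dist_lollipop_three]
  rw [hsum]
  ring

end Lollipop

/-- A unicyclic graph on `n ≥ 4` vertices has Wiener index at most
`W(L_{n,3}) = (n³ - 7n + 12)/6`. -/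
theorem wiener_unicyclic_le_lollipop_three
    {V : Type*} [Fintype V] (G : SimpleGraph V) (n : ℕ)
    (hcard : Fintype.card V = n) (hn : 4 ≤ n)
    (hconn : G.Connected) (huni : G.edgeSet.ncard = n) :
    wienerIndex G ≤ wienerIndex (lollipop n 3) ∧
    wienerIndex (lollipop n 3) = ((n : ℚ) ^ 3 - 7 * n + 12) / 6 := by
  have hlol := wienerIndex_lollipop_three (n := n) (by omega)
  refine ⟨?_, hlol⟩
  rw [hlol, ← hcard]
  exact wienerIndex_le_of_card_le_ncard_edgeSet hconn (by omega)
end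
end

section
/- For all integers n ≥ 4 and 0 ≤ s ≤ ⌊(n−4)/2⌋, the Szeged index of B(n,s) is Sz(B(n,s)) = (n−1)n(n+1)/6 + ns − s² − 4s − 1. -/
open SimpleGraph Finset
open scoped Classical

noncomputable section

/-- A function with the local behaviour of a distance is the graph distance. -/
theorem SimpleGraph.dist_eq_of_local {V : Type*} (G : SimpleGraph V) (f : V → V → ℕ)
    (self : ∀ w, f w w = 0)
    (lip : ∀ a b w, G.Adj a b → f a w ≤ f b w + 1)
    (descent : ∀ a w, a ≠ w → ∃ b, G.Adj a b ∧ f b w + 1 = f a w) (a w : V) :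
    G.dist a w = f a w := by
  have lower : ∀ {a w : V} (p : G.Walk a w), f a w ≤ p.length := by
    intro a w p
    induction p with
    | nil => simp [self]
    | cons h p ih =>
      rw [SimpleGraph.Walk.length_cons]
      exact (lip _ _ _ h).trans (Nat.add_le_add_right ih 1)
  have upper : ∀ (m : ℕ) (a w : V), f a w = m → ∃ p : G.Walk a w, p.length = m := by
    intro m
    induction m with
    | zero =>
      intro a w h
      by_cases haw : a = w
      · subst haw
        exact ⟨.nil, rfl⟩
      · obtain ⟨b, -, hb⟩ := descent a w haw
        omega
    | succ m ih =>
      intro a w h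
      have haw : a ≠ w := by
        rintro rfl
        simp [self] at h
      obtain ⟨b, hab, hb⟩ := descent a w haw
      obtain ⟨p, hp⟩ := ih b w (by omega)
      exact ⟨.cons hab p, by simp [hp]⟩
  obtain ⟨p, hp⟩ := upper _ a w rfl
  obtain ⟨q, hq⟩ := (SimpleGraph.Walk.reachable p).exists_walk_length_eq_dist
  exact le_antisymm (hp ▸ SimpleGraph.dist_le p) (hq ▸ lower q)

/-- The position of a vertex of `B(k + s + 4, s)` along the main path: the last vertex is a
twin of the vertex `k + 1`. -/
def bPos (k s a : ℕ) : ℕ := if a = k + s + 3 then k + 1 else a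

/-- The distance function of `B(k + s + 4, s)` in terms of vertex labels. -/
def bDist (k s a b : ℕ) : ℕ :=
  if a = b then 0
  else if bPos k s a = bPos k s b then 1
  else (bPos k s a - bPos k s b) + (bPos k s b - bPos k s a)

/-- The orientation of the edges of `B(k + s + 4, s)` from smaller to larger labels. -/
def bArc (k s a b : ℕ) : Prop :=
  (a + 1 = b ∧ b ≤ k + s + 2) ∨ (b = k + s + 3 ∧ (a = k ∨ a = k + 1 ∨ a = k + 2))

theorem Bgraph_adj_iff_s18 (k s : ℕ) (a b : Fin (k + s + 4)) :
    (Bgraph (k + s + 4) s).Adj a b ↔ bArc k s a b ∨ bArc k s b a := by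
  rw [Bgraph, SimpleGraph.fromRel_adj, ne_eq, Fin.ext_iff, bArc, bArc]
  omega

theorem Bgraph_dist_s18 (k s : ℕ) (a w : Fin (k + s + 4)) :
    (Bgraph (k + s + 4) s).dist a w = bDist k s a w := by
  refine SimpleGraph.dist_eq_of_local _ (fun a w : Fin (k + s + 4) => bDist k s a w) ?_ ?_ ?_ a w
  · intro w
    simp [bDist]
  · intro a b w h
    rw [Bgraph_adj_iff_s18] at h
    have := a.isLt
    have := b.isLt
    have := w.isLt
    simp only [bArc, bDist, bPos] at *
    split_ifs <;> omega
  · intro a w h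
    have ha := a.isLt
    have hw := w.isLt
    rw [ne_eq, Fin.ext_iff] at h
    have step : ∃ b, b < k + s + 4 ∧ (bArc k s a b ∨ bArc k s b a) ∧
        bDist k s b w + 1 = bDist k s a w := by
      by_cases hpos : bPos k s a = bPos k s w
      · refine ⟨w, hw, ?_, ?_⟩ <;> grind [bArc, bDist, bPos]
      · by_cases hlast : (a : ℕ) = k + s + 3
        · by_cases hlt : (w : ℕ) < k + 1
          · refine ⟨k, ?_, ?_, ?_⟩ <;> grind [bArc, bDist, bPos]
          · refine ⟨k + 2, ?_, ?_, ?_⟩ <;> grind [bArc, bDist, bPos]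
        · by_cases hnear : (w : ℕ) = k + s + 3 ∧ ((a : ℕ) = k ∨ (a : ℕ) = k + 2)
          · refine ⟨w, hw, ?_, ?_⟩ <;> grind [bArc, bDist, bPos]
          · by_cases hlt : bPos k s w < a
            · refine ⟨a - 1, ?_, ?_, ?_⟩ <;> grind [bArc, bDist, bPos]
            · refine ⟨a + 1, ?_, ?_, ?_⟩ <;> grind [bArc, bDist, bPos]
    obtain ⟨b, hb, hadj, hdist⟩ := step
    exact ⟨⟨b, hb⟩, (Bgraph_adj_iff_s18 k s a ⟨b, hb⟩).2 hadj, hdist⟩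

/-- The number of labels strictly closer to `a` than to `b` in `B(k + s + 4, s)`. -/
def bCloser (k s a b : ℕ) : ℕ :=
  #{w ∈ range (k + s + 4) | bDist k s a w < bDist k s b w}

theorem nCloser_Bgraph_s18 (k s : ℕ) (a b : Fin (k + s + 4)) :
    nCloser (Bgraph (k + s + 4) s) a b = bCloser k s a b := by
  simp only [nCloser, bCloser, Bgraph_dist_s18, Finset.card_filter]
  exact Fin.sum_univ_eq_sum_range
    (fun w => if bDist k s a w < bDist k s b w then 1 else 0) (k + s + 4)

theorem bCloser_eq_of_Ico {k s a b : ℕ} (l r : ℕ)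
    (h : ∀ w, (w < k + s + 4 ∧ bDist k s a w < bDist k s b w) ↔ (l ≤ w ∧ w < r)) :
    bCloser k s a b = r - l := by
  rw [bCloser, ← Nat.card_Ico]
  congr 1
  ext w
  simpa using h w

theorem bCloser_eq_of_insert_Ico {k s a b : ℕ} (l r : ℕ) (hr : r ≤ k + s + 3)
    (h : ∀ w, (w < k + s + 4 ∧ bDist k s a w < bDist k s b w) ↔
      (w = k + s + 3 ∨ l ≤ w ∧ w < r)) :
    bCloser k s a b = r - l + 1 := by
  rw [bCloser, ← Nat.card_Ico, ← Finset.card_insert_of_notMem (a := k + s + 3) (by simp; omega)]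
  congr 1
  ext w
  simpa using h w

/-- The contribution of an edge between the labels `a` and `b`. -/
def bWeight (k s a b : ℕ) : ℚ := bCloser k s a b * bCloser k s b a

theorem bWeight_left {k s a : ℕ} (h : a < k) :
    bWeight k s a (a + 1) = (a + 1) * (k + s + 3 - a) := by
  rw [bWeight, bCloser_eq_of_Ico 0 (a + 1), bCloser_eq_of_Ico (a + 1) (k + s + 4),
    Nat.sub_zero, Nat.cast_sub (by omega)]
  · push_cast; ring
  all_goals intro w; simp only [bDist, bPos]; split_ifs <;> omega

theorem bWeight_right {k s i : ℕ} (h : i < s) :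
    bWeight k s (k + 2 + i) (k + 2 + i + 1) = (k + i + 4) * (s - i) := by
  rw [bWeight, bCloser_eq_of_insert_Ico 0 (k + 2 + i + 1) (by omega),
    bCloser_eq_of_Ico (k + 2 + i + 1) (k + s + 3), Nat.cast_sub (by omega)]
  · push_cast; ring
  all_goals intro w; simp only [bDist, bPos]; split_ifs <;> omega

theorem bWeight_left_middle (k s : ℕ) :
    bWeight k s k (k + 1) = (k + 1) * (s + 2) := by
  rw [bWeight, bCloser_eq_of_Ico 0 (k + 1), bCloser_eq_of_Ico (k + 1) (k + s + 3),
    Nat.sub_zero, Nat.cast_sub (by omega)]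
  · push_cast; ring
  all_goals intro w; simp only [bDist, bPos]; split_ifs <;> omega

theorem bWeight_middle_right (k s : ℕ) :
    bWeight k s (k + 1) (k + 1 + 1) = (k + 2) * (s + 1) := by
  rw [bWeight, bCloser_eq_of_Ico 0 (k + 2), bCloser_eq_of_Ico (k + 2) (k + s + 3),
    Nat.sub_zero, Nat.cast_sub (by omega)]
  · push_cast; ring
  all_goals intro w; simp only [bDist, bPos]; split_ifs <;> omega

theorem bWeight_left_twin (k s : ℕ) :
    bWeight k s k (k + s + 3) = (k + 1) * (s + 2) := by
  rw [bWeight, bCloser_eq_of_Ico 0 (k + 1),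
    bCloser_eq_of_insert_Ico (k + 2) (k + s + 3) le_rfl, Nat.sub_zero,
    Nat.cast_add (_ - _), Nat.cast_sub (by omega)]
  · push_cast; ring
  all_goals intro w; simp only [bDist, bPos]; split_ifs <;> omega

theorem bWeight_middle_twin (k s : ℕ) :
    bWeight k s (k + 1) (k + s + 3) = 1 := by
  rw [bWeight, bCloser_eq_of_Ico (k + 1) (k + 2),
    bCloser_eq_of_Ico (k + s + 3) (k + s + 4)]
  · simp [Nat.add_sub_add_left]
  all_goals intro w; simp only [bDist, bPos]; split_ifs <;> omega

theorem bWeight_right_twin (k s : ℕ) :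
    bWeight k s (k + 2) (k + s + 3) = (k + 2) * (s + 1) := by
  rw [bWeight, bCloser_eq_of_Ico (k + 2) (k + s + 3),
    bCloser_eq_of_insert_Ico 0 (k + 1) (by omega), Nat.cast_sub (by omega)]
  · push_cast; ring
  all_goals intro w; simp only [bDist, bPos]; split_ifs <;> omega

theorem bWeight_comm (k s a b : ℕ) : bWeight k s a b = bWeight k s b a :=
  mul_comm _ _

theorem szeged_Bgraph_eq_sum_arcs (k s : ℕ) :
    szeged (Bgraph (k + s + 4) s) =
      ∑ a ∈ range (k + s + 4), ∑ b ∈ range (k + s + 4),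
        if bArc k s a b then bWeight k s a b else 0 := by
  have split : ∀ a b : ℕ, (if bArc k s a b ∨ bArc k s b a then bWeight k s a b else 0) =
      (if bArc k s a b then bWeight k s a b else 0) +
        (if bArc k s b a then bWeight k s b a else 0) := by
    intro a b
    have : ¬ (bArc k s a b ∧ bArc k s b a) := by
      simp only [bArc]; omega
    rw [bWeight_comm k s b a]
    split_ifs <;> first | tauto | simp
  have toRange : ∀ g : ℕ → ℕ → ℚ, ∑ a : Fin (k + s + 4), ∑ b : Fin (k + s + 4), g a b =
      ∑ a ∈ range (k + s + 4), ∑ b ∈ range (k + s + 4), g a b := by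
    intro g
    rw [← Fin.sum_univ_eq_sum_range (fun a => ∑ b ∈ range (k + s + 4), g a b)]
    exact Finset.sum_congr rfl fun a _ => Fin.sum_univ_eq_sum_range (g a) _
  have key : szeged (Bgraph (k + s + 4) s) =
      (∑ a : Fin (k + s + 4), ∑ b : Fin (k + s + 4),
        if bArc k s a b ∨ bArc k s b a then bWeight k s a b else 0) / 2 := by
    simp only [szeged, nCloser_Bgraph_s18, bWeight, Bgraph_adj_iff_s18]
  rw [key, toRange (fun a b => if bArc k s a b ∨ bArc k s b a then bWeight k s a b else 0)]
  simp only [split, Finset.sum_add_distrib]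
  rw [Finset.sum_comm (f := fun a b => if bArc k s b a then bWeight k s b a else 0)]
  ring

theorem sum_arcs_from (k s a : ℕ) :
    (∑ b ∈ range (k + s + 4), if bArc k s a b then bWeight k s a b else 0) =
      (if a < k + s + 2 then bWeight k s a (a + 1) else 0) +
        (if a = k ∨ a = k + 1 ∨ a = k + 2 then bWeight k s a (k + s + 3) else 0) := by
  rw [Finset.sum_range_succ]
  congr 1
  · have toEq : ∀ b ∈ range (k + s + 3), (if bArc k s a b then bWeight k s a b else 0) =
        if a + 1 = b then bWeight k s a b else 0 := by
      intro b hb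
      rw [mem_range] at hb
      congr 1
      simp only [bArc, eq_iff_iff]
      omega
    rw [Finset.sum_congr rfl toEq, Finset.sum_ite_eq]
    congr 1
    simp only [mem_range, eq_iff_iff]
    omega
  · refine if_congr ?_ rfl rfl
    rw [bArc]
    omega

theorem sum_path_edges (k s : ℕ) :
    ∑ a ∈ range (k + s + 2), bWeight k s a (a + 1) =
      ∑ a ∈ range k, ((a : ℚ) + 1) * (k + s + 3 - a) + (k + 1) * (s + 2) + (k + 2) * (s + 1) +
        ∑ i ∈ range s, ((k : ℚ) + i + 4) * (s - i) := by
  rw [show k + s + 2 = k + 2 + s by ring, Finset.sum_range_add, Finset.sum_range_succ,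
    Finset.sum_range_succ, bWeight_left_middle, bWeight_middle_right]
  congr 1
  · congr 2
    exact Finset.sum_congr rfl fun a ha => bWeight_left (by simpa using ha)
  · exact Finset.sum_congr rfl fun i hi => bWeight_right (by simpa using hi)

theorem sum_range_left (m : ℕ) (c : ℚ) :
    ∑ a ∈ range m, ((a : ℚ) + 1) * (c - a) = m * (m + 1) * (3 * c + 2 - 2 * m) / 6 := by
  induction m with
  | zero => simp
  | succ m ih => rw [Finset.sum_range_succ, ih]; push_cast; ring

theorem sum_range_right (m : ℕ) (c d : ℚ) :
    ∑ i ∈ range m, (c + i + 4) * (d - i) =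
      m * ((c + 4) * d) + (d - c - 4) * (m * (m - 1) / 2) - (m - 1) * m * (2 * m - 1) / 6 := by
  induction m with
  | zero => simp
  | succ m ih => rw [Finset.sum_range_succ, ih]; push_cast; ring

/-- Szeged index of `B(n,s)`. -/
theorem szeged_Bgraph
    (n s : ℕ) (hn : 4 ≤ n) (hs : s ≤ (n - 4) / 2) :
    szeged (Bgraph n s) =
      ((n : ℚ) - 1) * (n : ℚ) * ((n : ℚ) + 1) / 6 +
        (n : ℚ) * s - (s : ℚ) ^ 2 - 4 * s - 1 := by
  obtain ⟨k, rfl⟩ : ∃ k, n = k + s + 4 := ⟨n - s - 4, by omega⟩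
  rw [szeged_Bgraph_eq_sum_arcs]
  simp only [sum_arcs_from, Finset.sum_add_distrib]
  have path : (∑ a ∈ range (k + s + 4), if a < k + s + 2 then bWeight k s a (a + 1) else 0) =
      ∑ a ∈ range (k + s + 2), bWeight k s a (a + 1) := by
    rw [← Finset.sum_filter]
    congr 1
    ext a
    simp
    omega
  have twin : (∑ a ∈ range (k + s + 4),
      if a = k ∨ a = k + 1 ∨ a = k + 2 then bWeight k s a (k + s + 3) else 0) =
      (k + 1) * (s + 2) + 1 + (k + 2) * (s + 1) := by
    rw [← Finset.sum_filter, show {a ∈ range (k + s + 4) | a = k ∨ a = k + 1 ∨ a = k + 2} =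
      {k, k + 1, k + 2} by ext a; simp; omega]
    rw [Finset.sum_insert (by simp), Finset.sum_insert (by simp), Finset.sum_singleton,
      bWeight_left_twin, bWeight_middle_twin, bWeight_right_twin]
    ring
  rw [path, twin, sum_path_edges, sum_range_left, sum_range_right]
  push_cast
  ring
end
end

section
/- Let G = B_{k,l,t} be a theta graph on n vertices (so k + l + t = n + 1), and suppose n is even. Then W(G) ≤ (n³ − 4n + 8)/8. -/
open SimpleGraph Finset
open scoped Classical

noncomputable section

/-- The vertices `a 0, …, a p` form a walk of length `p` from `x` to `y`. -/
def IsArc {V : Type*} (G : SimpleGraph V) (x y : V) (a : ℕ → V) (p : ℕ) : Prop :=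
  a 0 = x ∧ a p = y ∧ ∀ m < p, G.Adj (a m) (a (m + 1))

/-- The closed sequence running along `a` for `p` steps and back along `b` for `q` steps. -/
def closeArcs {V : Type*} (a b : ℕ → V) (p q m : ℕ) : V :=
  if m ≤ p then a m else b (p + q - m)

section Arcs

variable {V : Type*} {G : SimpleGraph V} {x y : V} {a b c z : ℕ → V} {p q r N : ℕ}

lemma IsArc.exists_walk (h : IsArc G x y a p) (i m : ℕ) (hm : i + m ≤ p) :
    ∃ w : G.Walk (a i) (a (i + m)), w.length = m := by
  induction m with
  | zero => exact ⟨Walk.nil, rfl⟩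
  | succ m ih =>
    obtain ⟨w, hw⟩ := ih (by omega)
    exact ⟨w.concat (h.2.2 (i + m) (by omega)), by simp [hw]⟩

lemma IsArc.dist_le_sub (h : IsArc G x y a p) {i j : ℕ} (hij : i ≤ j) (hj : j ≤ p) :
    G.dist (a i) (a j) ≤ j - i := by
  obtain ⟨w, hw⟩ := h.exists_walk i (j - i) (by omega)
  have := SimpleGraph.dist_le w
  rwa [hw, show i + (j - i) = j by omega] at this

lemma IsArc.dist_le_wrap (h : IsArc G x x z N) {i j : ℕ} (hij : i ≤ j) (hj : j ≤ N) :
    G.dist (z i) (z j) ≤ N - (j - i) := by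
  obtain ⟨w, hw⟩ := h.exists_walk 0 i (by omega)
  obtain ⟨w', hw'⟩ := h.exists_walk j (N - j) (by omega)
  have e : z (j + (N - j)) = z 0 := by
    rw [show j + (N - j) = N by omega, h.2.1, h.1]
  have e' : z (0 + i) = z i := by rw [zero_add]
  have := SimpleGraph.dist_le ((w'.copy rfl e).append (w.copy rfl e'))
  rw [SimpleGraph.dist_comm]
  simp only [Walk.length_append, Walk.length_copy, hw, hw'] at this
  omega

lemma IsArc.two_mul_dist_le (h : IsArc G x x z N) {i j : ℕ} (hi : i ≤ N) (hj : j ≤ N) :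
    2 * G.dist (z i) (z j) ≤ N := by
  rcases le_total i j with hij | hij
  · have h1 := h.dist_le_sub hij hj
    have h2 := h.dist_le_wrap hij hj
    omega
  · have h1 := h.dist_le_sub hij hi
    have h2 := h.dist_le_wrap hij hi
    rw [SimpleGraph.dist_comm]
    omega

lemma four_mul_sum_min_le (N : ℕ) : 4 * ∑ m ∈ range N, min m (N - m) ≤ N ^ 2 := by
  induction N using Nat.twoStepInduction with
  | zero => simp
  | one => simp
  | more N ih _ =>
    have key : ∑ m ∈ range (N + 2), min m (N + 2 - m) =
        ∑ m ∈ range N, min m (N - m) + (N + 1) := by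
      rw [Finset.sum_range_succ']
      have : ∑ m ∈ range (N + 1), min (m + 1) (N + 2 - (m + 1)) =
          ∑ m ∈ range (N + 1), (min m (N - m) + 1) := by
        refine Finset.sum_congr rfl fun m hm => ?_
        rw [Finset.mem_range] at hm
        omega
      rw [this, Finset.sum_add_distrib, Finset.sum_range_succ]
      simp
    rw [key]
    nlinarith

lemma IsArc.four_mul_sum_dist_le (h : IsArc G x x z N) {i : ℕ} (hi : i ≤ N) :
    4 * ∑ j ∈ range N, G.dist (z i) (z j) ≤ N ^ 2 := by
  refine le_trans ?_ (four_mul_sum_min_le N)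
  have e1 : ∑ j ∈ range N, G.dist (z i) (z j) =
      ∑ j ∈ range i, G.dist (z i) (z j) + ∑ m ∈ range (N - i), G.dist (z i) (z (i + m)) := by
    rw [← Finset.sum_range_add, Nat.add_sub_cancel' hi]
  have e2 : ∑ m ∈ range N, min m (N - m) =
      ∑ m ∈ range (N - i), min m (N - m) +
        ∑ j ∈ range i, min (N - i + j) (N - (N - i + j)) := by
    rw [← Finset.sum_range_add, Nat.sub_add_cancel hi]
  have h1 : ∑ j ∈ range i, G.dist (z i) (z j) ≤
      ∑ j ∈ range i, min (N - i + j) (N - (N - i + j)) := by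
    refine Finset.sum_le_sum fun j hj => ?_
    rw [Finset.mem_range] at hj
    have h1 := h.dist_le_sub hj.le hi
    have h2 := h.dist_le_wrap hj.le hi
    rw [SimpleGraph.dist_comm]
    omega
  have h2 : ∑ m ∈ range (N - i), G.dist (z i) (z (i + m)) ≤
      ∑ m ∈ range (N - i), min m (N - m) := by
    refine Finset.sum_le_sum fun m hm => ?_
    rw [Finset.mem_range] at hm
    have h1 := h.dist_le_sub (i := i) (j := i + m) (by omega) (by omega)
    have h2 := h.dist_le_wrap (i := i) (j := i + m) (by omega) (by omega)
    omega
  omega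

lemma closeArcs_left {m : ℕ} (hm : m ≤ p) : closeArcs a b p q m = a m := if_pos hm

lemma closeArcs_right (ha : IsArc G x y a p) (hb : IsArc G x y b q) {j : ℕ} (hj : j ≤ q) :
    closeArcs a b p q (p + q - j) = b j := by
  unfold closeArcs
  split_ifs with h
  · obtain rfl : j = q := by omega
    rw [Nat.add_sub_cancel, ha.2.1, hb.2.1]
  · congr 1
    omega

lemma IsArc.closeArcs (ha : IsArc G x y a p) (hb : IsArc G x y b q) :
    IsArc G x x (closeArcs a b p q) (p + q) := by
  refine ⟨by rw [closeArcs_left (Nat.zero_le p), ha.1], ?_, fun m hm => ?_⟩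
  · have := closeArcs_right ha hb (Nat.zero_le q)
    rwa [Nat.sub_zero, hb.1] at this
  · by_cases h : m < p
    · rw [closeArcs_left h.le, closeArcs_left h]
      exact ha.2.2 m h
    · have e1 := closeArcs_right ha hb (j := p + q - m) (by omega)
      have e2 := closeArcs_right ha hb (j := p + q - m - 1) (by omega)
      rw [show p + q - (p + q - m) = m by omega] at e1
      rw [show p + q - (p + q - m - 1) = m + 1 by omega] at e2
      rw [e1, e2]
      have := hb.2.2 (p + q - m - 1) (by omega)
      rw [show p + q - m - 1 + 1 = p + q - m by omega] at this
      exact this.symm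

variable [Fintype V]

lemma sum_le_sum_closeArcs_add (ha : IsArc G x y a p) (hb : IsArc G x y b q)
    (hc : IsArc G x y c r) (hp : 0 < p) (hq : 0 < q)
    (hcov : ∀ v, (∃ j ≤ p, a j = v) ∨ (∃ j ≤ q, b j = v) ∨ ∃ j ≤ r, c j = v) (f : V → ℕ) :
    ∑ v, f v ≤ ∑ m ∈ range (p + q), f (closeArcs a b p q m) + ∑ j ∈ Ico 1 r, f (c j) := by
  have hsub : (univ : Finset V) ⊆
      (range (p + q)).image (closeArcs a b p q) ∪ (Ico 1 r).image c := by
    have hA : ∀ j ≤ p, a j ∈ (range (p + q)).image (closeArcs a b p q) := fun j hj =>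
      Finset.mem_image.2 ⟨j, Finset.mem_range.2 (by omega), closeArcs_left hj⟩
    intro v _
    rw [Finset.mem_union]
    rcases hcov v with ⟨j, hj, rfl⟩ | ⟨j, hj, rfl⟩ | ⟨j, hj, rfl⟩
    · exact Or.inl (hA j hj)
    · left
      rcases Nat.eq_zero_or_pos j with rfl | hj0
      · rw [hb.1, ← ha.1]
        exact hA 0 (Nat.zero_le p)
      · exact Finset.mem_image.2
          ⟨p + q - j, Finset.mem_range.2 (by omega), closeArcs_right ha hb hj⟩
    · rcases Nat.eq_zero_or_pos j with rfl | hj0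
      · left
        rw [hc.1, ← ha.1]
        exact hA 0 (Nat.zero_le p)
      · rcases hj.eq_or_lt with rfl | hjr
        · left
          rw [hc.2.1, ← ha.2.1]
          exact hA p le_rfl
        · exact Or.inr (Finset.mem_image_of_mem c (Finset.mem_Ico.2 ⟨hj0, hjr⟩))
  calc ∑ v, f v
      ≤ ∑ v ∈ (range (p + q)).image (closeArcs a b p q) ∪ (Ico 1 r).image c, f v :=
        Finset.sum_le_sum_of_subset hsub
    _ ≤ ∑ v ∈ (range (p + q)).image (closeArcs a b p q), f v + ∑ v ∈ (Ico 1 r).image c, f v := by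
        rw [← Finset.sum_union_inter]
        exact Nat.le_add_right _ _
    _ ≤ _ := add_le_add (Finset.sum_image_le_of_nonneg fun _ _ => Nat.zero_le _)
        (Finset.sum_image_le_of_nonneg fun _ _ => Nat.zero_le _)

/-- If three arcs of lengths `p`, `q`, `r + 1` with common ends cover the graph, then the
transmission of a vertex on the first arc is bounded by going around the first two arcs. -/
lemma four_mul_sum_dist_le_of_arcs (ha : IsArc G x y a p) (hb : IsArc G x y b q)
    (hc : IsArc G x y c (r + 1)) (hp : 0 < p) (hq : 0 < q)
    (hcov : ∀ v, (∃ j ≤ p, a j = v) ∨ (∃ j ≤ q, b j = v) ∨ ∃ j ≤ r + 1, c j = v)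
    {i : ℕ} (hi : i ≤ p) :
    4 * ∑ v, G.dist (a i) v ≤ (p + q) ^ 2 + 2 * (r * (p + r + 1)) := by
  have h1 := sum_le_sum_closeArcs_add ha hb hc hp hq hcov (G.dist (a i))
  have h2 := (ha.closeArcs hb).four_mul_sum_dist_le (i := i) (by omega)
  rw [closeArcs_left hi] at h2
  have h3 : 2 * ∑ j ∈ Ico 1 (r + 1), G.dist (a i) (c j) ≤ r * (p + r + 1) := by
    rw [Finset.mul_sum]
    have : ∀ j ∈ Ico 1 (r + 1), 2 * G.dist (a i) (c j) ≤ p + r + 1 := fun j hj => by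
      rw [Finset.mem_Ico] at hj
      have := (ha.closeArcs hc).two_mul_dist_le (i := i) (j := p + (r + 1) - j)
        (by omega) (by omega)
      rw [closeArcs_left hi, closeArcs_right ha hc hj.2.le] at this
      omega
    simpa using Finset.sum_le_card_nsmul _ _ _ this
  omega

/-- The transmission of an end of an arc of length one, in a graph covered by this arc and
two further arcs with the same ends. -/
lemma sum_dist_add_one_le_of_arcs (ha : IsArc G x y a 1) (hb : IsArc G x y b q)
    (hc : IsArc G x y c r) (hq : 0 < q) (hr : 0 < r)
    (hcov : ∀ v, (∃ j ≤ 1, a j = v) ∨ (∃ j ≤ q, b j = v) ∨ ∃ j ≤ r, c j = v)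
    {i : ℕ} (hi : i ≤ 1) :
    ∃ S T : ℕ, ∑ v, G.dist (a i) v + 1 ≤ S + T ∧ 4 * S ≤ (1 + q) ^ 2 ∧ 4 * T ≤ (1 + r) ^ 2 := by
  refine ⟨_, _, ?_, (ha.closeArcs hb).four_mul_sum_dist_le (i := i) (by omega),
    (ha.closeArcs hc).four_mul_sum_dist_le (i := i) (by omega)⟩
  rw [closeArcs_left hi, closeArcs_left hi]
  have h1 := sum_le_sum_closeArcs_add ha hb hc one_pos hq hcov (G.dist (a i))
  have h2 : ∑ j ∈ range (1 + r), G.dist (a i) (closeArcs a c 1 r j) =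
      1 + ∑ j ∈ Ico 1 r, G.dist (a i) (c j) := by
    obtain ⟨s, rfl⟩ : ∃ s, r = s + 1 := ⟨r - 1, by omega⟩
    have hadj : G.dist (a 0) (a 1) = 1 := SimpleGraph.dist_eq_one_iff_adj.2 (ha.2.2 0 one_pos)
    rw [show 1 + (s + 1) = 2 + s by omega, Finset.sum_range_add, Finset.sum_range_succ,
      Finset.sum_range_one, closeArcs_left (Nat.zero_le 1), closeArcs_left le_rfl]
    congr 1
    · interval_cases i
      · simp [hadj]
      · simp [SimpleGraph.dist_comm, hadj]
    · rw [Finset.sum_Ico_eq_sum_range, Nat.add_sub_cancel, ← Finset.sum_range_reflect]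
      refine Finset.sum_congr rfl fun j hj => ?_
      rw [Finset.mem_range] at hj
      rw [← closeArcs_right ha hc (j := 1 + j) (by omega)]
      congr 2
      omega
  omega

end Arcs

/-- The `j`-th vertex of the path of length `L` from `0` to `k` with internal vertices
`o + 1, …, o + L - 1`, in `Fin n`. -/
def thetaArc (n k o L : ℕ) (hn : 0 < n) (j : ℕ) : Fin n :=
  ⟨(if j = 0 then 0 else if j = L then k else o + j) % n, Nat.mod_lt _ hn⟩

lemma thetaArc_val {n k o L : ℕ} (hn : 0 < n) {j : ℕ} (hj : j ≤ L) (hk : k < n)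
    (ho : o + L ≤ n) :
    (thetaArc n k o L hn j).val = if j = 0 then 0 else if j = L then k else o + j := by
  refine Nat.mod_eq_of_lt ?_
  split_ifs <;> omega

section Theta

variable {k l t : ℕ}

lemma isArc_thetaArc_first (hk : 1 ≤ k) (hl : 2 ≤ l) (ht : 2 ≤ t) (hn : 0 < k + l + t - 1) :
    IsArc (theta k l t) ⟨0, hn⟩ ⟨k, by omega⟩ (thetaArc (k + l + t - 1) k 0 k hn) k := by
  have hv := fun j (hj : j ≤ k) =>
    thetaArc_val (k := k) (o := 0) hn hj (by omega) (by omega)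
  refine ⟨Fin.ext ?_, Fin.ext ?_, fun m hm => ?_⟩
  · simp [hv 0 (by omega)]
  · rw [hv k le_rfl]
    split_ifs <;> omega
  · simp only [theta, SimpleGraph.fromRel_adj, ne_eq, Fin.ext_iff, hv m hm.le, hv (m + 1) hm]
    grind

lemma isArc_thetaArc_second (hk : 1 ≤ k) (hl : 2 ≤ l) (ht : 2 ≤ t) (hn : 0 < k + l + t - 1) :
    IsArc (theta k l t) ⟨0, hn⟩ ⟨k, by omega⟩ (thetaArc (k + l + t - 1) k k l hn) l := by
  have hv := fun j (hj : j ≤ l) =>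
    thetaArc_val (k := k) (o := k) hn hj (by omega) (by omega)
  refine ⟨Fin.ext ?_, Fin.ext ?_, fun m hm => ?_⟩
  · simp [hv 0 (by omega)]
  · rw [hv l le_rfl]; split_ifs <;> simp <;> omega
  · simp only [theta, SimpleGraph.fromRel_adj, ne_eq, Fin.ext_iff, hv m hm.le, hv (m + 1) hm]
    grind

lemma isArc_thetaArc_third (hk : 1 ≤ k) (hl : 2 ≤ l) (ht : 2 ≤ t) (hn : 0 < k + l + t - 1) :
    IsArc (theta k l t) ⟨0, hn⟩ ⟨k, by omega⟩
      (thetaArc (k + l + t - 1) k (k + l - 1) t hn) t := by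
  have hv := fun j (hj : j ≤ t) =>
    thetaArc_val (k := k) (o := k + l - 1) hn hj (by omega) (by omega)
  refine ⟨Fin.ext ?_, Fin.ext ?_, fun m hm => ?_⟩
  · simp [hv 0 (by omega)]
  · rw [hv t le_rfl]; split_ifs <;> simp <;> omega
  · simp only [theta, SimpleGraph.fromRel_adj, ne_eq, Fin.ext_iff, hv m hm.le, hv (m + 1) hm]
    grind

lemma exists_thetaArc_eq (hk : 1 ≤ k) (hl : 2 ≤ l) (ht : 2 ≤ t) (hn : 0 < k + l + t - 1)
    (v : Fin (k + l + t - 1)) :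
    (∃ j ≤ k, thetaArc (k + l + t - 1) k 0 k hn j = v) ∨
    (∃ j ≤ l, thetaArc (k + l + t - 1) k k l hn j = v) ∨
    ∃ j ≤ t, thetaArc (k + l + t - 1) k (k + l - 1) t hn j = v := by
  have hv := v.isLt
  by_cases h1 : v.val ≤ k
  · refine Or.inl ⟨v.val, h1, Fin.ext ?_⟩
    rw [thetaArc_val hn h1 (by omega) (by omega)]
    split_ifs <;> omega
  by_cases h2 : v.val ≤ k + l - 1
  · refine Or.inr (Or.inl ⟨v.val - k, by omega, Fin.ext ?_⟩)
    rw [thetaArc_val hn (by omega) (by omega) (by omega)]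
    split_ifs <;> omega
  · refine Or.inr (Or.inr ⟨v.val - (k + l - 1), by omega, Fin.ext ?_⟩)
    rw [thetaArc_val hn (by omega) (by omega) (by omega)]
    split_ifs <;> omega

/-- The slack in the transmission bound for a vertex on an arc of length `p`. -/
lemma arc_bound_le_sq {p q r : ℕ} (h : r + 1 ≤ q) :
    (p + q) ^ 2 + 2 * (r * (p + r + 1)) + r * (q - 1) ≤ (p + q + r) ^ 2 := by
  obtain ⟨s, rfl⟩ : ∃ s, q = r + 1 + s := ⟨q - (r + 1), by omega⟩
  rw [show r + 1 + s - 1 = r + s by omega]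
  nlinarith [Nat.zero_le (r * s)]

lemma four_mul_sum_dist_theta_le (hk : 1 ≤ k) (hkl : k ≤ l) (hlt : l ≤ t) (hl : 2 ≤ l)
    (v : Fin (k + l + t - 1)) :
    4 * ∑ w, (theta k l t).dist v w + (k - 1) ≤ (k + l + t - 1) ^ 2 := by
  have ht : 2 ≤ t := by omega
  have hn : 0 < k + l + t - 1 := by omega
  have A := isArc_thetaArc_first hk hl ht hn
  have B := isArc_thetaArc_second hk hl ht hn
  have C := isArc_thetaArc_third hk hl ht hn
  have cov := exists_thetaArc_eq hk hl ht hn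
  obtain ⟨k, rfl⟩ : ∃ m, k = m + 1 := ⟨k - 1, by omega⟩
  obtain ⟨l, rfl⟩ : ∃ m, l = m + 1 := ⟨l - 1, by omega⟩
  rcases cov v with ⟨i, hi, rfl⟩ | ⟨i, hi, rfl⟩ | ⟨i, hi, rfl⟩
  · have h1 := four_mul_sum_dist_le_of_arcs A C B (by omega) (by omega)
      (fun v => (cov v).imp_right Or.symm) hi
    have h2 := arc_bound_le_sq (p := k + 1) (q := t) (r := l) (by omega)
    have h3 : k + 1 - 1 ≤ l * (t - 1) := by
      have := Nat.mul_le_mul (show 1 ≤ l by omega) (show k ≤ t - 1 by omega)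
      omega
    have e : (k + 1 + (l + 1) + t - 1) ^ 2 = (k + 1 + t + l) ^ 2 := by congr 1; omega
    omega
  · have h1 := four_mul_sum_dist_le_of_arcs B C A (by omega) (by omega)
      (fun v => or_rotate.1 (cov v)) hi
    have h2 := arc_bound_le_sq (p := l + 1) (q := t) (r := k) (by omega)
    have h3 : k + 1 - 1 ≤ k * (t - 1) := by
      have := Nat.mul_le_mul_left k (show 1 ≤ t - 1 by omega)
      omega
    have e : (k + 1 + (l + 1) + t - 1) ^ 2 = (l + 1 + t + k) ^ 2 := by congr 1; omega
    omega
  · have h1 := four_mul_sum_dist_le_of_arcs C B A (by omega) (by omega)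
      (fun v => (or_rotate.2 (cov v)).imp_right Or.symm) hi
    have h2 := arc_bound_le_sq (p := t) (q := l + 1) (r := k) (by omega)
    have h3 : k + 1 - 1 ≤ k * (l + 1 - 1) := by
      have := Nat.mul_le_mul_left k (show 1 ≤ l + 1 - 1 by omega)
      omega
    have e : (k + 1 + (l + 1) + t - 1) ^ 2 = (t + (l + 1) + k) ^ 2 := by congr 1; omega
    omega

lemma hub_bound {l t D S T : ℕ} (hl : 2 ≤ l) (ht : 2 ≤ t) (heven : Even (l + t))
    (hD : D + 1 ≤ S + T) (hS : 4 * S ≤ (1 + l) ^ 2) (hT : 4 * T ≤ (1 + t) ^ 2) :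
    4 * D + 2 * (l + t) ≤ (l + t) ^ 2 + 4 := by
  rcases Nat.even_or_odd l with hl' | hl'
  · obtain ⟨c, rfl⟩ := (Nat.even_add.1 heven).1 hl'
    obtain ⟨b, rfl⟩ := hl'
    have hS' : S ≤ b * b + b := by
      have : (1 + (b + b)) ^ 2 = 4 * (b * b + b) + 1 := by ring
      omega
    have hT' : T ≤ c * c + c := by
      have : (1 + (c + c)) ^ 2 = 4 * (c * c + c) + 1 := by ring
      omega
    obtain ⟨b, rfl⟩ : ∃ m, b = m + 1 := ⟨b - 1, by omega⟩
    obtain ⟨c, rfl⟩ : ∃ m, c = m + 1 := ⟨c - 1, by omega⟩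
    nlinarith [Nat.zero_le (b * c)]
  · have ht' : Odd t := by
      rw [← Nat.not_even_iff_odd] at hl' ⊢
      exact fun h => hl' ((Nat.even_add.1 heven).2 h)
    have hl3 : 3 ≤ l := by obtain ⟨b, rfl⟩ := hl'; omega
    have ht3 : 3 ≤ t := by obtain ⟨b, rfl⟩ := ht'; omega
    obtain ⟨b, rfl⟩ : ∃ m, l = m + 3 := ⟨l - 3, by omega⟩
    obtain ⟨c, rfl⟩ : ∃ m, t = m + 3 := ⟨t - 3, by omega⟩
    nlinarith [Nat.zero_le (b * c)]

lemma four_mul_sum_dist_theta_hub_le (hl : 2 ≤ l) (ht : 2 ≤ t) (heven : Even (l + t))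
    (v : Fin (1 + l + t - 1)) (hv : v.val ≤ 1) :
    4 * ∑ w, (theta 1 l t).dist v w + 2 * (l + t) ≤ (l + t) ^ 2 + 4 := by
  have hn : 0 < 1 + l + t - 1 := by omega
  have A := isArc_thetaArc_first le_rfl hl ht hn
  have B := isArc_thetaArc_second le_rfl hl ht hn
  have C := isArc_thetaArc_third le_rfl hl ht hn
  obtain ⟨S, T, hD, hS, hT⟩ := sum_dist_add_one_le_of_arcs A B C (by omega) (by omega)
    (exists_thetaArc_eq le_rfl hl ht hn) hv
  have e : thetaArc (1 + l + t - 1) 1 0 1 hn v.val = v := by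
    refine Fin.ext ?_
    rw [thetaArc_val hn hv (by omega) (by omega)]
    split_ifs <;> omega
  rw [e] at hD
  exact hub_bound hl ht heven hD hS hT

lemma four_mul_sum_sum_dist_theta_le (hk : 1 ≤ k) (hkl : k ≤ l) (hlt : l ≤ t) (hl : 2 ≤ l)
    (heven : Even (k + l + t - 1)) :
    4 * ∑ v, ∑ w, (theta k l t).dist v w + 4 * (k + l + t - 1) ≤ (k + l + t - 1) ^ 3 + 8 := by
  rw [Finset.mul_sum]
  rcases hk.eq_or_lt with rfl | hk2
  · have hrow : ∀ v : Fin (1 + l + t - 1),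
        4 * ∑ w, (theta 1 l t).dist v w + ((if v = ⟨0, by omega⟩ then 2 * (l + t) - 4 else 0) +
          (if v = ⟨1, by omega⟩ then 2 * (l + t) - 4 else 0)) ≤ (l + t) ^ 2 := by
      intro v
      have h1 := four_mul_sum_dist_theta_le hk hkl hlt hl v
      have e : 1 + l + t - 1 = l + t := by omega
      have e2 : (1 + l + t - 1) ^ 2 = (l + t) ^ 2 := by rw [e]
      rw [e] at heven
      have h2 := four_mul_sum_dist_theta_hub_le hl (by omega) heven v
      simp only [Fin.ext_iff]
      split_ifs <;> omega
    have h := Finset.sum_le_sum fun v (_ : v ∈ univ) => hrow v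
    rw [Finset.sum_add_distrib, Finset.sum_add_distrib, Finset.sum_ite_eq' univ,
      Finset.sum_ite_eq' univ, if_pos (mem_univ _), if_pos (mem_univ _), Finset.sum_const,
      Finset.card_univ, Fintype.card_fin, smul_eq_mul] at h
    have e : 1 + l + t - 1 = l + t := by omega
    have e3 : (1 + l + t - 1) * (l + t) ^ 2 = (1 + l + t - 1) ^ 3 := by rw [e]; ring
    omega
  · have hrow : ∀ v : Fin (k + l + t - 1),
        4 * ∑ w, (theta k l t).dist v w + 4 ≤ (k + l + t - 1) ^ 2 := by
      intro v
      have h1 := four_mul_sum_dist_theta_le hk hkl hlt hl v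
      obtain ⟨s, hs⟩ := heven
      have e : (k + l + t - 1) ^ 2 = 4 * (s * s) := by rw [hs]; ring
      omega
    have h := Finset.sum_le_sum fun v (_ : v ∈ univ) => hrow v
    rw [Finset.sum_add_distrib, Finset.sum_const, Finset.sum_const,
      Finset.card_univ, Fintype.card_fin, smul_eq_mul, smul_eq_mul] at h
    have e3 : (k + l + t - 1) * (k + l + t - 1) ^ 2 = (k + l + t - 1) ^ 3 := by ring
    omega

end Theta

/-- A theta graph `B_{k,l,t}` on an even number `n = k + l + t - 1`
of vertices has Wiener index at most `(n³ - 4n + 8)/8`. -/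
theorem wiener_theta_le
    (k l t n : ℕ) (hk : 1 ≤ k) (hkl : k ≤ l) (hlt : l ≤ t) (hl : 2 ≤ l)
    (hn : n = k + l + t - 1) (heven : Even n) :
    wienerIndex (theta k l t) ≤ ((n : ℚ) ^ 3 - 4 * n + 8) / 8 := by
  subst hn
  have h := four_mul_sum_sum_dist_theta_le hk hkl hlt hl heven
  have h' : (4 * ∑ v, ∑ w, ((theta k l t).dist v w : ℚ)) + 4 * ((k + l + t - 1 : ℕ) : ℚ) ≤
      ((k + l + t - 1 : ℕ) : ℚ) ^ 3 + 8 := by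
    exact_mod_cast h
  unfold wienerIndex
  linarith
end
end
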